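/- arXiv:math/9902073 — 5 statements merged into one kernel-verified Lean document; each statement's English description precedes it below -/
import Mathlib

section
/- Let F be a field of characteristic zero and V an F-linear subspace of the polynomial ring F[x_1,…,x_n]. Then V is translation-invariant (i.e., for every a ∈ F^n and every f ∈ V, the polynomial x ↦ f(x + a) lies in V) if and only if V is closed under each partial derivative ∂/∂x_i, i = 1,…,n. -/
open MvPolynomial

/-- The Taylor expansion `f ↦ f (x + t a)` along the direction `a`, as a polynomial in `t`. -/
noncomputable def lineExpansion {σ F : Type*} [CommRing F] (a : σ → F) :
    MvPolynomial σ F →ₐ[F] Polynomial (MvPolynomial σ F) :=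
  aeval fun i => Polynomial.C (X i) + Polynomial.C (C (a i)) * Polynomial.X

theorem lineExpansion_X {σ F : Type*} [CommRing F] (a : σ → F) (i : σ) :
    lineExpansion a (X i) = Polynomial.C (X i) + Polynomial.C (C (a i)) * Polynomial.X :=
  aeval_X _ i

theorem lineExpansion_C {σ F : Type*} [CommRing F] (a : σ → F) (r : F) :
    lineExpansion a (C r) = Polynomial.C (C r) :=
  aeval_C _ r

theorem eval_lineExpansion {σ F : Type*} [CommRing F] (a : σ → F) (t : F)
    (f : MvPolynomial σ F) :
    (lineExpansion a f).eval (C t) = aeval (fun i => X i + C (t * a i)) f := by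
  induction f using MvPolynomial.induction_on with
  | C r => rw [lineExpansion_C, Polynomial.eval_C, aeval_C, MvPolynomial.algebraMap_eq]
  | add p q hp hq => simp [hp, hq]
  | mul_X p i hp =>
    simp only [map_mul, Polynomial.eval_mul, hp, aeval_X, lineExpansion_X, Polynomial.eval_add,
      Polynomial.eval_C, Polynomial.eval_X, mul_comm t]

theorem derivative_lineExpansion {σ F : Type*} [Fintype σ] [CommRing F] (a : σ → F)
    (f : MvPolynomial σ F) :
    (lineExpansion a f).derivative = lineExpansion a (∑ i, a i • pderiv i f) := by
  classical
  induction f using MvPolynomial.induction_on with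
  | C r => simp
  | add p q hp hq => simp only [map_add, hp, hq, smul_add, Finset.sum_add_distrib]
  | mul_X p i hp =>
    have h : ∑ j, a j • pderiv j (p * X i) = (∑ j, a j • pderiv j p) * X i + C (a i) * p := by
      simp only [Derivation.leibniz, smul_add, Finset.sum_add_distrib, pderiv_X, Finset.sum_mul]
      rw [add_comm]
      congr 1
      · exact Finset.sum_congr rfl fun j _ => by simp [mul_comm]
      · rw [Finset.sum_eq_single i]
        · simp [MvPolynomial.smul_eq_C_mul]
        · intro j _ hj
          simp [Pi.single_eq_of_ne hj.symm]
        · simp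
    rw [h, map_mul, Polynomial.derivative_mul, hp, map_add, map_mul, map_mul, lineExpansion_X,
      lineExpansion_C]
    simp only [Polynomial.derivative_add, Polynomial.derivative_C, Polynomial.derivative_C_mul,
      Polynomial.derivative_X]
    ring

theorem coeff_zero_lineExpansion {σ F : Type*} [CommRing F] (a : σ → F)
    (f : MvPolynomial σ F) : (lineExpansion a f).coeff 0 = f := by
  have h := eval_lineExpansion a 0 f
  rw [C_0, ← Polynomial.coeff_zero_eq_eval_zero] at h
  simpa using h

/-- If a polynomial with coefficients in an algebra takes values in a subspace at every scalar
of an infinite field, then all its coefficients lie in that subspace. -/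
theorem Polynomial.coeff_mem_of_forall_eval_algebraMap_mem {F A : Type*} [Field F] [Infinite F]
    [CommRing A] [Algebra F A] (V : Submodule F A) (P : Polynomial A)
    (h : ∀ t : F, P.eval (algebraMap F A t) ∈ V) (k : ℕ) : P.coeff k ∈ V := by
  by_contra hk
  obtain ⟨φ, hφ, hV⟩ := Submodule.exists_le_ker_of_notMem hk
  let Q : Polynomial F := ∑ j ∈ P.support, Polynomial.monomial j (φ (P.coeff j))
  have hQ : Q = 0 := by
    refine Polynomial.funext fun t => ?_
    have ht : φ (P.eval (algebraMap F A t)) = 0 := hV (h t)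
    rw [Polynomial.eval_eq_sum, Polynomial.sum, map_sum] at ht
    rw [Polynomial.eval_finsetSum, Polynomial.eval_zero, ← ht]
    refine Finset.sum_congr rfl fun j _ => ?_
    rw [Polynomial.eval_monomial, ← map_pow, mul_comm (P.coeff j), ← Algebra.smul_def, map_smul,
      smul_eq_mul, mul_comm]
  apply hφ
  have hc : Q.coeff k = φ (P.coeff k) := by
    simp only [Q, Polynomial.finsetSum_coeff, Polynomial.coeff_monomial, Finset.sum_ite_eq']
    split_ifs with hs
    · rfl
    · rw [Polynomial.notMem_support_iff.mp hs, map_zero]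
  rw [← hc, hQ, Polynomial.coeff_zero]

theorem coeff_lineExpansion_mem {σ F : Type*} [Fintype σ] [Field F] [CharZero F]
    (V : Submodule F (MvPolynomial σ F)) (hV : ∀ i, ∀ f ∈ V, pderiv i f ∈ V)
    (a : σ → F) (k : ℕ) : ∀ f ∈ V, (lineExpansion a f).coeff k ∈ V := by
  induction k with
  | zero => exact fun f hf => by rwa [coeff_zero_lineExpansion]
  | succ k ih =>
    intro f hf
    have h := ih _ (V.sum_mem fun i (_ : i ∈ Finset.univ) => V.smul_mem (a i) (hV i f hf))
    rw [← derivative_lineExpansion, Polynomial.coeff_derivative] at h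
    have hk : (k + 1 : F) ≠ 0 := by exact_mod_cast k.succ_ne_zero
    refine (V.smul_mem_iff hk).mp ?_
    rwa [MvPolynomial.smul_eq_C_mul, mul_comm, map_add, map_natCast, map_one]

/-- over a field of characteristic zero, a subspace V ⊆ F[x_1,…,x_n] is
translation-invariant iff it is closed under each partial derivative ∂/∂x_i. -/
theorem stmt_3 (F : Type*) [Field F] [CharZero F] (n : ℕ)
    (V : Submodule F (MvPolynomial (Fin n) F)) :
    (∀ a : Fin n → F, ∀ f ∈ V,
        MvPolynomial.aeval (fun i => MvPolynomial.X i + MvPolynomial.C (a i)) f ∈ V) ↔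
    (∀ i : Fin n, ∀ f ∈ V, MvPolynomial.pderiv i f ∈ V) := by
  constructor
  · intro h i f hf
    have hc := Polynomial.coeff_mem_of_forall_eval_algebraMap_mem V
      (lineExpansion (Pi.single i 1) f)
      (fun t => by
        rw [MvPolynomial.algebraMap_eq, eval_lineExpansion]
        exact h _ f hf) 1
    have hd := Polynomial.coeff_derivative (lineExpansion (Pi.single i (1 : F)) f) 0
    rw [derivative_lineExpansion, coeff_zero_lineExpansion] at hd
    simp only [Pi.single_apply, ite_smul, one_smul, zero_smul, Finset.sum_ite_eq',
      Finset.mem_univ, if_true, Nat.cast_zero, zero_add, mul_one] at hd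
    rwa [hd]
  · intro h a f hf
    have he := eval_lineExpansion a 1 f
    simp only [one_mul, C_1] at he
    rw [← he, Polynomial.eval_eq_sum, Polynomial.sum]
    refine V.sum_mem fun k _ => ?_
    rw [one_pow, mul_one]
    exact coeff_lineExpansion_mem V h a k f hf
end

section
/- Let F be a field of characteristic zero and R a commutative local F-algebra that is finite-dimensional as an F-vector space, with maximal ideal m and residue field R/m isomorphic to F. Every element x of m is nilpotent, so exp(x) = Σ_{k≥0} x^k/k! is a well-defined element of R. If U ⊆ m is an F-subspace with U + m² = m, then the F-linear span of the set {exp(u) : u ∈ U} is all of R. -/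
/-- The exponential of a nilpotent element of an F-algebra (char F = 0): the finite sum
`Σ_{k < N} x^k / k!`, where `N` is the nilpotency class of `x`. -/
noncomputable def nilpotentExp (F : Type*) [Field F] [CharZero F] {R : Type*} [CommRing R]
    [Algebra F R] (x : R) : R :=
  ∑ k ∈ Finset.range (nilpotencyClass x), ((k.factorial : F)⁻¹) • x ^ k

open IsLocalRing in
/-- The maximal ideal of a local Artinian ring is nilpotent. -/
theorem isNilpotent_maximalIdeal_of_isArtinianRing (R : Type*) [CommRing R] [IsLocalRing R]
    [IsArtinianRing R] : IsNilpotent (maximalIdeal R) := by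
  have h := IsArtinianRing.isNilpotent_jacobson_bot (R := R)
  rwa [jacobson_eq_maximalIdeal ⊥ bot_ne_top] at h

section NilpotentExp

variable (F : Type*) [Field F] [CharZero F] {R : Type*} [CommRing R] [Algebra F R]

theorem nilpotentExp_eq_exp [Module ℚ R] (x : R) : nilpotentExp F x = IsNilpotent.exp x := by
  unfold nilpotentExp IsNilpotent.exp
  exact Finset.sum_congr rfl fun k _ => inv_natCast_smul_eq F ℚ k.factorial (x ^ k)

theorem nilpotentExp_zero : nilpotentExp F (0 : R) = 1 := by
  let : Module ℚ R := Module.compHom R (algebraMap ℚ F)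
  rw [nilpotentExp_eq_exp, IsNilpotent.exp_zero]

theorem nilpotentExp_add {x y : R} (hx : IsNilpotent x) (hy : IsNilpotent y) :
    nilpotentExp F (x + y) = nilpotentExp F x * nilpotentExp F y := by
  let : Module ℚ R := Module.compHom R (algebraMap ℚ F)
  simp only [nilpotentExp_eq_exp]
  exact IsNilpotent.exp_add_of_commute (Commute.all x y) hx hy

theorem nilpotentExp_sub_one_sub_mem_sq {I : Ideal R} {x : R} (hI : x ∈ I)
    (hx : IsNilpotent x) : nilpotentExp F x - 1 - x ∈ I ^ 2 := by
  let : Module ℚ R := Module.compHom R (algebraMap ℚ F)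
  obtain ⟨n, hn⟩ := hx
  have hn' : x ^ (n + 2) = 0 := by rw [pow_add, hn, zero_mul]
  rw [nilpotentExp_eq_exp, IsNilpotent.exp_eq_sum hn', Finset.sum_range_succ',
    Finset.sum_range_succ']
  simp only [zero_add, Nat.factorial_zero, Nat.factorial_one, Nat.cast_one, inv_one, one_smul,
    pow_zero, pow_one, add_sub_cancel_right]
  refine Ideal.sum_mem _ fun k _ => ?_
  rw [← inv_natCast_smul_eq F ℚ, Algebra.smul_def]
  refine Ideal.mul_mem_left _ _ ?_
  rw [add_assoc, pow_add]
  exact Ideal.mul_mem_left _ _ (Ideal.pow_mem_pow hI 2)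

end NilpotentExp

/-- An additive subgroup closed under multiplication which generates a nilpotent ideal modulo its
square contains that ideal. -/
theorem Ideal.le_of_isNilpotent_of_forall_sub_mem_sq {R : Type*} [CommRing R] {I : Ideal R}
    (hI : IsNilpotent I) {S : NonUnitalSubring R}
    (h : ∀ x ∈ I, ∃ s ∈ S, s ∈ I ∧ x - s ∈ I ^ 2) {x : R} (hx : x ∈ I) : x ∈ S := by
  have key : ∀ n : ℕ, ∀ x ∈ I, ∃ s ∈ S, s ∈ I ∧ x - s ∈ I ^ (n + 1) := by
    intro n
    induction n with
    | zero => exact fun x hx => ⟨0, S.zero_mem, I.zero_mem, by simpa using hx⟩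
    | succ n ih =>
      have hsq : ∀ y ∈ I ^ 2, ∃ s ∈ S, s ∈ I ∧ y - s ∈ I ^ (n + 1 + 1) := by
        intro y hy
        rw [pow_two] at hy
        refine Submodule.mul_induction_on hy ?_ ?_
        · intro a ha b hb
          obtain ⟨s, hs, hsI, has⟩ := ih a ha
          obtain ⟨t, ht, -, hbt⟩ := ih b hb
          refine ⟨s * t, S.mul_mem hs ht, I.mul_mem_right _ hsI, ?_⟩
          have e : a * b - s * t = (a - s) * b + (b - t) * s := by ring
          rw [e, pow_succ]
          exact add_mem (Ideal.mul_mem_mul has hb) (Ideal.mul_mem_mul hbt hsI)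
        · rintro a b ⟨s, hs, hsI, has⟩ ⟨t, ht, htI, hbt⟩
          refine ⟨s + t, S.add_mem hs ht, I.add_mem hsI htI, ?_⟩
          rw [add_sub_add_comm]
          exact add_mem has hbt
      intro x hx
      obtain ⟨s, hs, hsI, hxs⟩ := h x hx
      obtain ⟨t, ht, htI, hxt⟩ := hsq _ hxs
      exact ⟨s + t, S.add_mem hs ht, I.add_mem hsI htI, by rwa [← sub_sub]⟩
  obtain ⟨n, hn⟩ := hI
  obtain ⟨s, hs, -, hxs⟩ := key n x hx
  rw [pow_succ, hn, zero_mul, Ideal.zero_eq_bot, Ideal.mem_bot, sub_eq_zero] at hxs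
  exact hxs ▸ hs

/-- let R be a finite-dimensional commutative local F-algebra (char F = 0) with
residue field F.  Then every element of the maximal ideal m is nilpotent, and for any
F-subspace U ⊆ m with U + m² = m, the span of {exp(u) : u ∈ U} is all of R. -/
theorem stmt_7 (F R : Type*) [Field F] [CharZero F] [CommRing R] [Algebra F R]
    [IsLocalRing R] [FiniteDimensional F R]
    (hres : Nonempty (IsLocalRing.ResidueField R ≃ₐ[F] F)) :
    (∀ x ∈ IsLocalRing.maximalIdeal R, IsNilpotent x) ∧
    (∀ U : Submodule F R, (∀ u ∈ U, u ∈ IsLocalRing.maximalIdeal R) →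
      (∀ x ∈ IsLocalRing.maximalIdeal R,
        ∃ u ∈ U, ∃ v ∈ (IsLocalRing.maximalIdeal R) ^ 2, x = u + v) →
      Submodule.span F (nilpotentExp F '' (U : Set R)) = ⊤) := by
  have : IsArtinianRing R := IsArtinianRing.of_finite F R
  have hm := isNilpotent_maximalIdeal_of_isArtinianRing R
  have hnil : ∀ x ∈ IsLocalRing.maximalIdeal R, IsNilpotent x := by
    obtain ⟨n, hn⟩ := hm
    refine fun x hx => ⟨n, ?_⟩
    simpa [hn] using Ideal.pow_mem_pow hx n
  refine ⟨hnil, fun U hU hUm => ?_⟩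
  have hexp : ∀ u ∈ U, nilpotentExp F u ∈ Submodule.span F (nilpotentExp F '' (U : Set R)) :=
    fun u hu => Submodule.subset_span ⟨u, hu, rfl⟩
  have hone : (1 : R) ∈ Submodule.span F (nilpotentExp F '' (U : Set R)) := by
    simpa only [nilpotentExp_zero] using hexp 0 U.zero_mem
  have hmul : ∀ a b, a ∈ Submodule.span F (nilpotentExp F '' (U : Set R)) →
      b ∈ Submodule.span F (nilpotentExp F '' (U : Set R)) →
      a * b ∈ Submodule.span F (nilpotentExp F '' (U : Set R)) := by
    intro a b ha hb
    have hab := Submodule.mul_mem_mul ha hb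
    rw [Submodule.span_mul_span] at hab
    refine Submodule.span_le.2 ?_ hab
    rintro _ ⟨_, ⟨u, hu, rfl⟩, _, ⟨v, hv, rfl⟩, rfl⟩
    simpa only [SetLike.mem_coe, nilpotentExp_add F (hnil u (hU u hu)) (hnil v (hU v hv))]
      using hexp (u + v) (U.add_mem hu hv)
  let A : Subalgebra F R := Submodule.toSubalgebra _ hone hmul
  have hmA : ∀ x ∈ IsLocalRing.maximalIdeal R, x ∈ A := by
    intro x hx
    refine Ideal.le_of_isNilpotent_of_forall_sub_mem_sq hm
      (S := A.toSubring.toNonUnitalSubring) (fun y hy => ?_) hx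
    obtain ⟨u, hu, v, hv, rfl⟩ := hUm y hy
    have hsq := nilpotentExp_sub_one_sub_mem_sq F (hU u hu) (hnil u (hU u hu))
    refine ⟨nilpotentExp F u - 1, A.sub_mem (hexp u hu) A.one_mem, ?_, ?_⟩
    · rw [← sub_add_cancel (nilpotentExp F u - 1) u]
      exact add_mem (Ideal.pow_le_self two_ne_zero hsq) (hU u hu)
    · have e : u + v - (nilpotentExp F u - 1) = v - (nilpotentExp F u - 1 - u) := by ring
      rw [e]
      exact sub_mem hv hsq
  rw [eq_top_iff]
  rintro x -
  obtain ⟨e⟩ := hres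
  have hx : x - algebraMap F R (e (IsLocalRing.residue R x)) ∈ IsLocalRing.maximalIdeal R := by
    rw [← IsLocalRing.residue_eq_zero_iff, map_sub, sub_eq_zero,
      ← IsLocalRing.ResidueField.algebraMap_eq, ← IsScalarTower.algebraMap_apply]
    exact e.injective (by rw [AlgEquiv.commutes]; rfl)
  have hxA : x ∈ A := by
    rw [← sub_add_cancel x (algebraMap F R (e (IsLocalRing.residue R x)))]
    exact A.add_mem (hmA _ hx) (A.algebraMap_mem _)
  exact hxA
end

section
/- Let F be an algebraically closed field of characteristic zero. Every commutative local F-algebra R of dimension 3 as an F-vector space is isomorphic as an F-algebra to exactly one of: F[X]/(X³), or F[X,Y]/(X², XY, Y²). Moreover, these two algebras are not isomorphic to each other. -/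
section NilpotentSquares

open MvPolynomial

variable {F : Type*} [Field F]

/-- The square of the maximal ideal at the origin of the affine plane. -/
noncomputable abbrev planeOriginSqIdeal (F : Type*) [Field F] : Ideal (MvPolynomial (Fin 2) F) :=
  Ideal.span {(X 0 : MvPolynomial (Fin 2) F) ^ 2, X 0 * X 1, (X 1) ^ 2}

lemma exists_linear_sub_mem_planeOriginSqIdeal (p : MvPolynomial (Fin 2) F) :
    ∃ a b c : F, p - (C a + C b * X 0 + C c * X 1) ∈ planeOriginSqIdeal F := by
  have h₀₀ : (X 0 : MvPolynomial (Fin 2) F) ^ 2 ∈ planeOriginSqIdeal F :=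
    Ideal.subset_span (by simp)
  have h₀₁ : (X 0 * X 1 : MvPolynomial (Fin 2) F) ∈ planeOriginSqIdeal F :=
    Ideal.subset_span (by simp)
  have h₁₁ : (X 1 : MvPolynomial (Fin 2) F) ^ 2 ∈ planeOriginSqIdeal F :=
    Ideal.subset_span (by simp)
  induction p using MvPolynomial.induction_on with
  | C a => exact ⟨a, 0, 0, by simp⟩
  | add p q hp hq =>
    obtain ⟨a, b, c, h⟩ := hp
    obtain ⟨a', b', c', h'⟩ := hq
    refine ⟨a + a', b + b', c + c', ?_⟩
    convert add_mem h h' using 1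
    simp only [map_add]
    ring
  | mul_X p i hp =>
    obtain ⟨a, b, c, h⟩ := hp
    fin_cases i
    · refine ⟨0, a, 0, ?_⟩
      convert add_mem (Ideal.mul_mem_left _ (X 0) h)
        (add_mem (Ideal.mul_mem_left _ (C b) h₀₀) (Ideal.mul_mem_left _ (C c) h₀₁)) using 1
      simp only [map_zero, Fin.zero_eta]
      ring
    · refine ⟨0, 0, a, ?_⟩
      convert add_mem (Ideal.mul_mem_left _ (X 1) h)
        (add_mem (Ideal.mul_mem_left _ (C b) h₀₁) (Ideal.mul_mem_left _ (C c) h₁₁)) using 1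
      simp only [map_zero, Fin.mk_one]
      ring

/-- Every nilpotent element of `F[X, Y] / (X², XY, Y²)` squares to zero. -/
lemma sq_eq_zero_of_isNilpotent_planeOriginSq
    {z : MvPolynomial (Fin 2) F ⧸ planeOriginSqIdeal F} (hz : IsNilpotent z) : z ^ 2 = 0 := by
  obtain ⟨p, rfl⟩ := Ideal.Quotient.mk_surjective z
  obtain ⟨n, hn⟩ := hz
  rw [← map_pow, Ideal.Quotient.eq_zero_iff_mem] at hn
  have hle : planeOriginSqIdeal F ≤ RingHom.ker (constantCoeff (R := F) (σ := Fin 2)) := by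
    rw [Ideal.span_le]
    rintro _ (rfl | rfl | rfl) <;> simp [RingHom.mem_ker]
  have hp : constantCoeff p = 0 := by
    have := hle hn
    rw [RingHom.mem_ker, map_pow] at this
    exact eq_zero_of_pow_eq_zero this
  obtain ⟨a, b, c, h⟩ := exists_linear_sub_mem_planeOriginSqIdeal p
  obtain rfl : a = 0 := by
    have := hle h
    simpa [RingHom.mem_ker, hp] using this
  rw [Ideal.Quotient.mk_eq_mk_iff_sub_mem _ _ |>.mpr h, ← map_pow, Ideal.Quotient.eq_zero_iff_mem]
  have h₀₀ : (X 0 : MvPolynomial (Fin 2) F) ^ 2 ∈ planeOriginSqIdeal F :=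
    Ideal.subset_span (by simp)
  have h₀₁ : (X 0 * X 1 : MvPolynomial (Fin 2) F) ∈ planeOriginSqIdeal F :=
    Ideal.subset_span (by simp)
  have h₁₁ : (X 1 : MvPolynomial (Fin 2) F) ^ 2 ∈ planeOriginSqIdeal F :=
    Ideal.subset_span (by simp)
  convert add_mem (Ideal.mul_mem_left _ (C b ^ 2) h₀₀)
    (add_mem (Ideal.mul_mem_left _ (2 * C b * C c) h₀₁)
      (Ideal.mul_mem_left _ (C c ^ 2) h₁₁)) using 1
  simp only [map_zero]
  ring

lemma exists_isNilpotent_sq_ne_zero_quotient_X_pow_three :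
    ∃ z : Polynomial F ⧸ Ideal.span {(Polynomial.X : Polynomial F) ^ 3},
      IsNilpotent z ∧ z ^ 2 ≠ 0 := by
  refine ⟨Ideal.Quotient.mk _ Polynomial.X, ⟨3, ?_⟩, ?_⟩
  · rw [← map_pow, Ideal.Quotient.eq_zero_iff_mem]
    exact Ideal.mem_span_singleton_self _
  · rw [← map_pow, Ne, Ideal.Quotient.eq_zero_iff_mem, Ideal.mem_span_singleton,
      pow_dvd_pow_iff Polynomial.X_ne_zero Polynomial.not_isUnit_X]
    norm_num

lemma isEmpty_algEquiv_quotient_X_pow_three_planeOriginSq :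
    IsEmpty ((Polynomial F ⧸ Ideal.span {(Polynomial.X : Polynomial F) ^ 3}) ≃ₐ[F]
      (MvPolynomial (Fin 2) F ⧸ planeOriginSqIdeal F)) := by
  refine ⟨fun e => ?_⟩
  obtain ⟨z, hz, hz2⟩ := exists_isNilpotent_sq_ne_zero_quotient_X_pow_three (F := F)
  apply hz2
  apply e.injective
  rw [map_pow, map_zero]
  exact sq_eq_zero_of_isNilpotent_planeOriginSq (hz.map e)

variable {R : Type*} [CommRing R] [Algebra F R]

/-- A three-dimensional algebra with a nilpotent element whose square is nonzero is
`F[X] / (X³)`. -/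
lemma nonempty_algEquiv_quotient_X_pow_three (hdim : Module.finrank F R = 3) {x : R}
    (hx : IsNilpotent x) (hx2 : x ^ 2 ≠ 0) :
    Nonempty (R ≃ₐ[F] (Polynomial F ⧸ Ideal.span {(Polynomial.X : Polynomial F) ^ 3})) := by
  have : Module.Finite F R := Module.finite_of_finrank_eq_succ hdim
  obtain ⟨n, hn⟩ := hx
  have hmonic := minpoly.monic (Algebra.IsIntegral.isIntegral (R := F) x)
  obtain ⟨k, -, hk⟩ := (dvd_prime_pow Polynomial.prime_X n).mp
    (minpoly.dvd F x (p := Polynomial.X ^ n) (by simpa using hn))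
  replace hk := Polynomial.eq_of_monic_of_associated hmonic (Polynomial.monic_X_pow k) hk
  have hxk : x ^ k = 0 := by simpa [hk] using minpoly.aeval F x
  have hle : k ≤ 3 := by
    have := minpoly.natDegree_le (A := F) x
    rwa [hk, Polynomial.natDegree_X_pow, hdim] at this
  obtain rfl : k = 3 := by
    by_contra hne
    exact hx2 (pow_eq_zero_of_le (show k ≤ 2 by omega) hxk)
  have hker : RingHom.ker (Polynomial.aeval (R := F) x) = Ideal.span {Polynomial.X ^ 3} := by
    rw [minpoly.ker_aeval_eq_span_minpoly, hk]
  let f := Ideal.kerLiftAlg (Polynomial.aeval (R := F) x)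
  have hinj : Function.Injective f := Ideal.kerLiftAlg_injective _
  have : Module.Finite F (Polynomial F ⧸ RingHom.ker (Polynomial.aeval (R := F) x)) :=
    Module.Finite.of_injective f.toLinearMap hinj
  have hfinrank : Module.finrank F (Polynomial F ⧸ RingHom.ker (Polynomial.aeval (R := F) x)) =
      Module.finrank F R := by
    rw [hker, finrank_quotient_span_eq_natDegree, Polynomial.natDegree_X_pow, hdim]
  have hsurj : Function.Surjective f :=
    (LinearMap.injective_iff_surjective_of_finrank_eq_finrank (f := f.toLinearMap) hfinrank).mp hinj
  exact ⟨((Ideal.quotientEquivAlgOfEq F hker).symm.trans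
    (AlgEquiv.ofBijective f ⟨hinj, hsurj⟩)).symm⟩

/-- A three-dimensional local algebra over an algebraically closed field of characteristic
other than two, all of whose non-units square to zero, is `F[X, Y] / (X², XY, Y²)`. -/
lemma nonempty_algEquiv_planeOriginSq [IsAlgClosed F] (h2 : (2 : F) ≠ 0) [IsLocalRing R]
    (hdim : Module.finrank F R = 3) (hsq : ∀ x ∈ IsLocalRing.maximalIdeal R, x ^ 2 = 0) :
    Nonempty (R ≃ₐ[F] (MvPolynomial (Fin 2) F ⧸ planeOriginSqIdeal F)) := by
  have : Module.Finite F R := Module.finite_of_finrank_eq_succ hdim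
  have hmul : ∀ x ∈ IsLocalRing.maximalIdeal R, ∀ y ∈ IsLocalRing.maximalIdeal R,
      x * y = 0 := by
    intro x hx y hy
    have h : (2 : F) • (x * y) = 0 := by
      rw [ofNat_smul_eq_nsmul]
      linear_combination hsq _ (add_mem hx hy) - hsq x hx - hsq y hy
    exact (smul_eq_zero.mp h).resolve_left h2
  let M : Submodule F R := (IsLocalRing.maximalIdeal R).restrictScalars F
  have hbij : Function.Bijective (algebraMap F (R ⧸ IsLocalRing.maximalIdeal R)) :=
    IsAlgClosed.algebraMap_bijective_of_isIntegral
  have hquot : Module.finrank F (R ⧸ M) = 1 := by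
    have e : F ≃ₗ[F] (R ⧸ IsLocalRing.maximalIdeal R) :=
      LinearEquiv.ofBijective (Algebra.linearMap F _) hbij
    have e' : (R ⧸ M) ≃ₗ[F] (R ⧸ IsLocalRing.maximalIdeal R) :=
      Submodule.Quotient.restrictScalarsEquiv F _
    rw [e'.finrank_eq, ← e.finrank_eq, Module.finrank_self]
  have hM : Module.finrank F M = 2 := by
    have := Submodule.finrank_quotient_add_finrank M
    omega
  let v := Module.finBasisOfFinrankEq F M hM
  let f : MvPolynomial (Fin 2) F →ₐ[F] R := aeval fun i => (v i : R)
  have hv (i) : (v i : R) ∈ IsLocalRing.maximalIdeal R := (v i).2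
  have hle : planeOriginSqIdeal F ≤ RingHom.ker f := by
    rw [Ideal.span_le]
    rintro _ (rfl | rfl | rfl) <;> simp [RingHom.mem_ker, f, hsq _ (hv _), hmul _ (hv _) _ (hv _)]
  have hf (a b c : F) : f (C a + C b * X 0 + C c * X 1) =
      algebraMap F R a + ((b • v 0 + c • v 1 : M) : R) := by
    simp [f, Algebra.smul_def, add_assoc]
  have hsurj : Function.Surjective f := by
    intro r
    obtain ⟨a, ha⟩ := hbij.2 (Ideal.Quotient.mk _ r)
    have hr : r - algebraMap F R a ∈ M := by
      apply (Ideal.Quotient.mk_eq_mk_iff_sub_mem _ _).mp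
      rw [← ha]
      rfl
    refine ⟨C a + C (v.repr ⟨_, hr⟩ 0) * X 0 + C (v.repr ⟨_, hr⟩ 1) * X 1, ?_⟩
    rw [hf, ← Fin.sum_univ_two (fun i => v.repr ⟨_, hr⟩ i • v i), v.sum_repr]
    simp
  have hker : RingHom.ker f = planeOriginSqIdeal F := by
    refine le_antisymm (fun p hp => ?_) hle
    obtain ⟨a, b, c, h⟩ := exists_linear_sub_mem_planeOriginSqIdeal p
    have hzero : algebraMap F R a + ((b • v 0 + c • v 1 : M) : R) = 0 := by
      have h' := hle h
      rw [RingHom.mem_ker] at hp h'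
      rwa [map_sub, hp, zero_sub, neg_eq_zero, hf] at h'
    obtain rfl : a = 0 := by
      by_contra ha
      have hmem : algebraMap F R a ∈ IsLocalRing.maximalIdeal R := by
        rw [eq_neg_of_add_eq_zero_left hzero]
        exact neg_mem (b • v 0 + c • v 1 : M).2
      exact hmem ((Ne.isUnit ha).map _)
    rw [map_zero, zero_add, ZeroMemClass.coe_eq_zero] at hzero
    have hbc := Fintype.linearIndependent_iff.mp v.linearIndependent ![b, c] (by simpa using hzero)
    obtain rfl : b = 0 := hbc 0
    obtain rfl : c = 0 := hbc 1
    simpa using h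
  exact ⟨((Ideal.quotientEquivAlgOfEq F hker).symm.trans
    (Ideal.quotientKerAlgEquivOfSurjective hsurj)).symm⟩

end NilpotentSquares


open MvPolynomial in
/-- over an algebraically closed field F of characteristic zero, every
commutative local F-algebra of F-dimension 3 is isomorphic to exactly one of
F[X]/(X³) and F[X,Y]/(X², XY, Y²), and these two are not isomorphic. -/
theorem stmt_8 (F : Type*) [Field F] [IsAlgClosed F] [CharZero F]
    (R : Type*) [CommRing R] [Algebra F R] [IsLocalRing R]
    (hdim : Module.finrank F R = 3) :
    Xor'
      (Nonempty (R ≃ₐ[F] (Polynomial F ⧸ Ideal.span {(Polynomial.X : Polynomial F) ^ 3})))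
      (Nonempty (R ≃ₐ[F] (MvPolynomial (Fin 2) F ⧸
        Ideal.span {(X 0 : MvPolynomial (Fin 2) F) ^ 2, X 0 * X 1, (X 1) ^ 2}))) ∧
    IsEmpty ((Polynomial F ⧸ Ideal.span {(Polynomial.X : Polynomial F) ^ 3}) ≃ₐ[F]
      (MvPolynomial (Fin 2) F ⧸
        Ideal.span {(X 0 : MvPolynomial (Fin 2) F) ^ 2, X 0 * X 1, (X 1) ^ 2})) := by
  have : Module.Finite F R := Module.finite_of_finrank_eq_succ hdim
  have : IsArtinianRing R := IsArtinianRing.of_finite F R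
  have hempty := isEmpty_algEquiv_quotient_X_pow_three_planeOriginSq (F := F)
  refine ⟨?_, hempty⟩
  by_cases hsq : ∀ x ∈ IsLocalRing.maximalIdeal R, x ^ 2 = 0
  · obtain ⟨e⟩ := nonempty_algEquiv_planeOriginSq (F := F) two_ne_zero hdim hsq
    exact Or.inr ⟨⟨e⟩, fun ⟨e'⟩ => hempty.false (e'.symm.trans e)⟩
  · push Not at hsq
    obtain ⟨x, hx, hx2⟩ := hsq
    obtain ⟨e⟩ := nonempty_algEquiv_quotient_X_pow_three (F := F) hdim
      (Ring.KrullDimLE.isNilpotent_iff_mem_maximalIdeal.mpr hx) hx2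
    exact Or.inl ⟨⟨e⟩, fun ⟨e'⟩ => hempty.false (e.symm.trans e')⟩
end

section
/- Let F be an algebraically closed field of characteristic zero. There are only finitely many isomorphism classes of commutative local F-algebras of dimension 6 as F-vector spaces: there exists a finite list R_1, …, R_k of commutative local F-algebras of F-dimension 6 such that every commutative local F-algebra of F-dimension 6 is isomorphic as an F-algebra to some R_i. -/
universe u

/-- A commutative local F-algebra of dimension ℓ as an F-vector space. -/
structure LocalAlgebraOfDim (F : Type u) [Field F] (ℓ : ℕ) : Type (u + 1) where
  carrier : Type u
  [commRing : CommRing carrier]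
  [algebra : Algebra F carrier]
  isLocal : IsLocalRing carrier
  finrank_eq : Module.finrank F carrier = ℓ

attribute [instance] LocalAlgebraOfDim.commRing LocalAlgebraOfDim.algebra
  LocalAlgebraOfDim.isLocal

section

open Submodule

/-- A finite set spanning `N` which, together with `0`, is closed under multiplication. -/
def HasMonomialSpan {F R : Type*} [Field F] [CommRing R] [Algebra F R]
    (N : Submodule F R) (n : ℕ) : Prop :=
  ∃ s : Finset R, s.card ≤ n ∧ N ≤ span F (s : Set R) ∧
    ∀ u ∈ s, ∀ v ∈ s, u * v = 0 ∨ u * v ∈ s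

section Span

variable {F R : Type*} [Field F] [CommRing R] [Algebra F R]

local notation "𝒞" => algebraMap F R

theorem mem_span_five {x y z a b v : R} :
    v ∈ span F ({x, y, z, a, b} : Set R) ↔ ∃ c₁ c₂ c₃ c₄ c₅ : F,
      v = 𝒞 c₁ * x + 𝒞 c₂ * y + 𝒞 c₃ * z + 𝒞 c₄ * a + 𝒞 c₅ * b := by
  simp only [mem_span_insert, mem_span_singleton, Algebra.smul_def]
  constructor
  · rintro ⟨c₁, _, ⟨c₂, _, ⟨c₃, _, ⟨c₄, _, ⟨c₅, rfl⟩, rfl⟩, rfl⟩, rfl⟩, rfl⟩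
    exact ⟨c₁, c₂, c₃, c₄, c₅, by ring⟩
  · rintro ⟨c₁, c₂, c₃, c₄, c₅, rfl⟩
    exact ⟨c₁, _, ⟨c₂, _, ⟨c₃, _, ⟨c₄, _, ⟨c₅, rfl⟩, rfl⟩, rfl⟩, rfl⟩, by ring⟩

theorem span_five_le {x y z a b : R} {p : Submodule F R} (hx : x ∈ p) (hy : y ∈ p) (hz : z ∈ p)
    (ha : a ∈ p) (hb : b ∈ p) : span F ({x, y, z, a, b} : Set R) ≤ p := by
  rw [span_le]
  rintro v (rfl | rfl | rfl | rfl | rfl) <;> assumption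

theorem Submodule.algebraMap_mul_mem {p : Submodule F R} (c : F) {x : R} (hx : x ∈ p) :
    𝒞 c * x ∈ p := by
  rw [← Algebra.smul_def]; exact p.smul_mem c hx

theorem algebraMap_mul_algebraMap_inv {c : F} (hc : c ≠ 0) : 𝒞 c * 𝒞 c⁻¹ = 1 := by
  rw [← map_mul, mul_inv_cancel₀ hc, map_one]

open Classical in
theorem HasMonomialSpan.of_five {N : Submodule F R} {x y z a b : R}
    (hN : N ≤ span F ({x, y, z, a, b} : Set R))
    (h : ∀ u ∈ ({x, y, z, a, b} : Finset R), ∀ v ∈ ({x, y, z, a, b} : Finset R),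
      u * v = 0 ∨ u * v ∈ ({x, y, z, a, b} : Finset R)) :
    HasMonomialSpan N 5 :=
  ⟨{x, y, z, a, b}, Finset.card_le_five, by simpa using hN, h⟩

/-- Elements `x, y, z, a, b` spanning the nilpotent algebra `N`, with `a` and `b` annihilating
`N`. -/
structure SocleFrame (N : Submodule F R) (x y z a b : R) : Prop where
  le_span : N ≤ span F ({x, y, z, a, b} : Set R)
  mem_x : x ∈ N
  mem_y : y ∈ N
  mem_z : z ∈ N
  mem_a : a ∈ N
  mem_b : b ∈ N
  mul_a : ∀ v ∈ N, v * a = 0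
  mul_b : ∀ v ∈ N, v * b = 0

namespace SocleFrame

variable {N : Submodule F R} {x y z a b : R}

theorem hasMonomialSpan (h : SocleFrame N x y z a b)
    (hxx : x * x = 0 ∨ x * x = a ∨ x * x = b) (hxy : x * y = 0 ∨ x * y = a ∨ x * y = b)
    (hxz : x * z = 0 ∨ x * z = a ∨ x * z = b) (hyy : y * y = 0 ∨ y * y = a ∨ y * y = b)
    (hyz : y * z = 0 ∨ y * z = a ∨ y * z = b) (hzz : z * z = 0 ∨ z * z = a ∨ z * z = b) :
    HasMonomialSpan N 5 := by
  classical
  refine .of_five h.le_span ?_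
  have h0 : ∀ u ∈ ({x, y, z, a, b} : Finset R), u ∈ N := by
    intro u hu
    simp only [Finset.mem_insert, Finset.mem_singleton] at hu
    rcases hu with rfl | rfl | rfl | rfl | rfl
    exacts [h.mem_x, h.mem_y, h.mem_z, h.mem_a, h.mem_b]
  have key : ∀ w : R, (w = 0 ∨ w = a ∨ w = b) → w = 0 ∨ w ∈ ({x, y, z, a, b} : Finset R) := by
    rintro w (h | h | h) <;> simp [h]
  intro u hu v hv
  have hu' := h0 u hu
  have hv' := h0 v hv
  apply key
  simp only [Finset.mem_insert, Finset.mem_singleton] at hu hv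
  have h1 := h.mul_a u hu'
  have h2 := h.mul_b u hu'
  have h3 := h.mul_a v hv'
  have h4 := h.mul_b v hv'
  rw [mul_comm] at h3 h4
  rcases hu with rfl | rfl | rfl | rfl | rfl <;> rcases hv with rfl | rfl | rfl | rfl | rfl <;>
    first
    | assumption
    | (left; assumption)
    | (rw [mul_comm]; assumption)

theorem swap (h : SocleFrame N x y z a b) : SocleFrame N x z y a b :=
  { h with
    le_span := h.le_span.trans (by rw [Set.insert_comm y z])
    mem_y := h.mem_z
    mem_z := h.mem_y }

theorem smul_x (h : SocleFrame N x y z a b) {c : F} (hc : c ≠ 0) :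
    SocleFrame N (𝒞 c * x) y z a b :=
  { h with
    le_span := h.le_span.trans <| span_five_le
      (mem_span_five.2 ⟨c⁻¹, 0, 0, 0, 0, by
        simp; linear_combination -x * algebraMap_mul_algebraMap_inv (R := R) hc⟩)
      (subset_span (by simp)) (subset_span (by simp)) (subset_span (by simp))
      (subset_span (by simp))
    mem_x := algebraMap_mul_mem c h.mem_x }

theorem smul_y (h : SocleFrame N x y z a b) {c : F} (hc : c ≠ 0) :
    SocleFrame N x (𝒞 c * y) z a b :=
  { h with
    le_span := h.le_span.trans <| span_five_le (subset_span (by simp))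
      (mem_span_five.2 ⟨0, c⁻¹, 0, 0, 0, by
        simp; linear_combination -y * algebraMap_mul_algebraMap_inv (R := R) hc⟩)
      (subset_span (by simp)) (subset_span (by simp))
      (subset_span (by simp))
    mem_y := algebraMap_mul_mem c h.mem_y }

theorem smul_z (h : SocleFrame N x y z a b) {c : F} (hc : c ≠ 0) :
    SocleFrame N x y (𝒞 c * z) a b :=
  (h.swap.smul_y hc).swap

theorem smul_a (h : SocleFrame N x y z a b) {c : F} (hc : c ≠ 0) :
    SocleFrame N x y z (𝒞 c * a) b :=
  { h with
    le_span := h.le_span.trans <| span_five_le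
      (subset_span (by simp)) (subset_span (by simp)) (subset_span (by simp))
      (mem_span_five.2 ⟨0, 0, 0, c⁻¹, 0, by
        simp; linear_combination -a * algebraMap_mul_algebraMap_inv (R := R) hc⟩)
      (subset_span (by simp))
    mem_a := algebraMap_mul_mem c h.mem_a
    mul_a := fun v hv => by linear_combination 𝒞 c * h.mul_a v hv }

theorem change_b (h : SocleFrame N x y z a b) (p : F) {q : F} (hq : q ≠ 0) :
    SocleFrame N x y z a (𝒞 p * a + 𝒞 q * b) :=
  { h with
    le_span := h.le_span.trans <| span_five_le
      (subset_span (by simp)) (subset_span (by simp)) (subset_span (by simp))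
      (subset_span (by simp))
      (mem_span_five.2 ⟨0, 0, 0, -(q⁻¹ * p), q⁻¹, by
        simp; linear_combination -b * algebraMap_mul_algebraMap_inv (R := R) hq⟩)
    mem_b := add_mem (algebraMap_mul_mem p h.mem_a) (algebraMap_mul_mem q h.mem_b)
    mul_b := fun v hv => by linear_combination 𝒞 p * h.mul_a v hv + 𝒞 q * h.mul_b v hv }

theorem add_yx (h : SocleFrame N x y z a b) (c : F) : SocleFrame N x (y + 𝒞 c * x) z a b :=
  { h with
    le_span := h.le_span.trans <| span_five_le (subset_span (by simp))
      (mem_span_five.2 ⟨-c, 1, 0, 0, 0, by simp⟩)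
      (subset_span (by simp)) (subset_span (by simp)) (subset_span (by simp))
    mem_y := add_mem h.mem_y (algebraMap_mul_mem c h.mem_x) }

theorem add_yz (h : SocleFrame N x y z a b) (c : F) : SocleFrame N x (y + 𝒞 c * z) z a b :=
  { h with
    le_span := h.le_span.trans <| span_five_le (subset_span (by simp))
      (mem_span_five.2 ⟨0, 1, -c, 0, 0, by simp⟩)
      (subset_span (by simp)) (subset_span (by simp)) (subset_span (by simp))
    mem_y := add_mem h.mem_y (algebraMap_mul_mem c h.mem_z) }

theorem add_zx (h : SocleFrame N x y z a b) (c : F) : SocleFrame N x y (z + 𝒞 c * x) a b :=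
  (h.swap.add_yx c).swap

theorem add_zy (h : SocleFrame N x y z a b) (c : F) : SocleFrame N x y (z + 𝒞 c * y) a b :=
  (h.swap.add_yz c).swap

end SocleFrame

end Span

section Pencil

variable {F R : Type*} [Field F] [CommRing R] [Algebra F R]

local notation "𝒞" => algebraMap F R

theorem exists_mul_self_mul_eq_one [IsAlgClosed F] {r : F} (hr : r ≠ 0) :
    ∃ e : F, e ≠ 0 ∧ e * e * r = 1 := by
  obtain ⟨e, he⟩ := IsAlgClosed.exists_eq_mul_self r⁻¹
  have h : e * e * r = 1 := by rw [← he, inv_mul_cancel₀ hr]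
  refine ⟨e, ?_, h⟩
  rintro rfl
  simp at h

theorem exists_quadratic_root [IsAlgClosed F] [CharZero F] {a : F} (ha : a ≠ 0) (b c : F) :
    ∃ t, a * (t * t) + b * t + c = 0 := by
  obtain ⟨s, hs⟩ := IsAlgClosed.exists_eq_mul_self (discrim a b c)
  exact exists_quadratic_eq_zero ha ⟨s, hs⟩

namespace SocleFrame

variable {N : Submodule F R} {x y z a b : R}

section Nilpotent

variable [IsAlgClosed F]

theorem hasMonomialSpan_of_zz (h : SocleFrame N x y z a b) (hxx : x * x = 0) (hxy : x * y = 0)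
    (hxz : x * z = a) (hyy : y * y = b) (hyz : y * z = 0) {q : F} (hzz : z * z = 𝒞 q * b) :
    HasMonomialSpan N 5 := by
  rcases eq_or_ne q 0 with rfl | hq
  · exact h.hasMonomialSpan (.inl hxx) (.inl hxy) (.inr <| .inl hxz) (.inr <| .inr hyy)
      (.inl hyz) (.inl (by simpa using hzz))
  · obtain ⟨e, he, heq⟩ := exists_mul_self_mul_eq_one hq
    replace heq : 𝒞 e * 𝒞 e * 𝒞 q = 1 := by simp only [← map_mul, heq, map_one]
    refine ((h.smul_z he).smul_a he).hasMonomialSpan (.inl hxx) (.inl hxy)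
      (.inr <| .inl ?_) (.inr <| .inr hyy) (.inl ?_) (.inr <| .inr ?_)
    · linear_combination 𝒞 e * hxz
    · linear_combination 𝒞 e * hyz
    · linear_combination 𝒞 e * 𝒞 e * hzz + b * heq

variable [CharZero F]

theorem hasMonomialSpan_of_yy_eq (h : SocleFrame N x y z a b) (hxx : x * x = 0)
    (hxy : x * y = 0) (hxz : x * z = a) (hyy : y * y = b) {p₂ q₂ p₃ q₃ : F}
    (hyz : y * z = 𝒞 p₂ * a + 𝒞 q₂ * b) (hzz : z * z = 𝒞 p₃ * a + 𝒞 q₃ * b) :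
    HasMonomialSpan N 5 := by
  obtain ⟨s, hs⟩ : ∃ s : F, 2 * s = p₃ - 2 * q₂ * p₂ := ⟨(p₃ - 2 * q₂ * p₂) / 2, by ring⟩
  replace hs := congrArg 𝒞 hs
  simp only [map_mul, map_sub, map_ofNat] at hs
  refine (((h.add_zy (-q₂)).add_yx (-p₂)).add_zx (-s)).hasMonomialSpan_of_zz
    (q := q₃ - q₂ * q₂) hxx ?_ ?_ ?_ ?_ ?_ <;> simp only [map_neg, map_sub, map_mul]
  · linear_combination hxy - 𝒞 p₂ * hxx
  · linear_combination hxz - 𝒞 q₂ * hxy - 𝒞 s * hxx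
  · linear_combination hyy - 2 * 𝒞 p₂ * hxy + 𝒞 p₂ ^ 2 * hxx
  · linear_combination hyz - 𝒞 q₂ * hyy - 𝒞 s * hxy - 𝒞 p₂ * hxz + 𝒞 p₂ * 𝒞 q₂ * hxy
      + 𝒞 p₂ * 𝒞 s * hxx
  · linear_combination hzz - 2 * 𝒞 q₂ * hyz + 𝒞 q₂ ^ 2 * hyy - 2 * 𝒞 s * hxz
      + 2 * 𝒞 s * 𝒞 q₂ * hxy + 𝒞 s ^ 2 * hxx - a * hs

omit [CharZero F] [IsAlgClosed F] in
theorem hasMonomialSpan_of_yy (h : SocleFrame N x y z a b) (hxx : x * x = 0) (hxy : x * y = 0)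
    (hxz : x * z = a) {r : F} (hyy : y * y = 𝒞 r * a) (hyz : y * z = 0 ∨ y * z = b)
    (hzz : z * z = 0 ∨ z * z = b) : HasMonomialSpan N 5 := by
  rcases eq_or_ne r 0 with rfl | hr
  · exact h.hasMonomialSpan (.inl hxx) (.inl hxy) (.inr <| .inl hxz)
      (.inl (by simpa using hyy)) (hyz.imp_right .inr) (hzz.imp_right .inr)
  · refine ((h.smul_x hr).smul_a hr).hasMonomialSpan (.inl ?_) (.inl ?_) (.inr <| .inl ?_)
      (.inr <| .inl hyy) (hyz.imp_right .inr) (hzz.imp_right .inr)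
    · linear_combination 𝒞 r ^ 2 * hxx
    · linear_combination 𝒞 r * hxy
    · linear_combination 𝒞 r * hxz

theorem hasMonomialSpan_of_xx_eq_zero (h : SocleFrame N x y z a b) (hxx : x * x = 0)
    (hxy : x * y = 0) (hxz : x * z = a) {p₁ q₁ p₂ q₂ p₃ q₃ : F}
    (hyy : y * y = 𝒞 p₁ * a + 𝒞 q₁ * b) (hyz : y * z = 𝒞 p₂ * a + 𝒞 q₂ * b)
    (hzz : z * z = 𝒞 p₃ * a + 𝒞 q₃ * b) (hq : ¬ (q₁ = 0 ∧ q₂ = 0 ∧ q₃ = 0)) :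
    HasMonomialSpan N 5 := by
  rcases ne_or_eq q₁ 0 with h₁ | rfl
  · have hi := algebraMap_mul_algebraMap_inv (R := R) h₁
    refine (h.change_b p₁ h₁).hasMonomialSpan_of_yy_eq (p₂ := p₂ - p₁ * (q₁⁻¹ * q₂))
      (q₂ := q₁⁻¹ * q₂) (p₃ := p₃ - p₁ * (q₁⁻¹ * q₃)) (q₃ := q₁⁻¹ * q₃) hxx hxy hxz hyy ?_ ?_ <;>
      simp only [map_sub, map_mul]
    · linear_combination hyz - 𝒞 q₂ * b * hi
    · linear_combination hzz - 𝒞 q₃ * b * hi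
  replace hyy : y * y = 𝒞 p₁ * a := by simpa using hyy
  rcases ne_or_eq q₂ 0 with h₂ | rfl
  · obtain ⟨g, hg⟩ : ∃ g : F, 2 * g * q₂ = -q₃ := ⟨-q₃ / (2 * q₂), by field_simp⟩
    obtain ⟨s, hs⟩ : ∃ s : F, 2 * s = p₃ + 2 * g * p₂ + g * g * p₁ :=
      ⟨(p₃ + 2 * g * p₂ + g * g * p₁) / 2, by ring⟩
    replace hg := congrArg 𝒞 hg
    replace hs := congrArg 𝒞 hs
    simp only [map_mul, map_add, map_ofNat, map_neg] at hs hg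
    refine (((h.change_b (p₂ + g * p₁) h₂).add_zy g).add_zx (-s)).hasMonomialSpan_of_yy
      (r := p₁) hxx hxy ?_ ?_ (.inr ?_) (.inl ?_) <;>
      try simp only [map_add, map_neg, map_mul]
    · linear_combination hxz + 𝒞 g * hxy - 𝒞 s * hxx
    · exact hyy
    · linear_combination hyz + 𝒞 g * hyy - 𝒞 s * hxy
    · linear_combination hzz + 2 * 𝒞 g * hyz + 𝒞 g ^ 2 * hyy - 2 * 𝒞 s * hxz
        - 2 * 𝒞 s * 𝒞 g * hxy + 𝒞 s ^ 2 * hxx - a * hs + b * hg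
  · have h₃ : q₃ ≠ 0 := fun h => hq ⟨rfl, rfl, h⟩
    replace hyz : y * z = 𝒞 p₂ * a := by simpa using hyz
    refine ((h.change_b p₃ h₃).add_yx (-p₂)).hasMonomialSpan_of_yy
      (r := p₁) hxx ?_ hxz ?_ (.inl ?_) (.inr hzz) <;>
      try simp only [map_neg]
    · linear_combination hxy - 𝒞 p₂ * hxx
    · linear_combination hyy - 2 * 𝒞 p₂ * hxy + 𝒞 p₂ ^ 2 * hxx
    · linear_combination hyz - 𝒞 p₂ * hxz

end Nilpotent

section Idempotent

variable [IsAlgClosed F]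

theorem hasMonomialSpan_of_square_scalars (h : SocleFrame N x y z a b) (hxx : x * x = a)
    (hxy : x * y = 0) (hxz : x * z = 0) {r s : F} (hyy : y * y = 𝒞 r * a) (hyz : y * z = b)
    (hzz : z * z = 𝒞 s * a) : HasMonomialSpan N 5 := by
  have scale : ∀ r : F, ∃ e : F, e ≠ 0 ∧ (e * e * r = 0 ∨ e * e * r = 1) := by
    intro r
    rcases eq_or_ne r 0 with rfl | hr
    · exact ⟨1, one_ne_zero, .inl (by simp)⟩
    · obtain ⟨e, he, h⟩ := exists_mul_self_mul_eq_one hr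
      exact ⟨e, he, .inr h⟩
  obtain ⟨e, he, her⟩ := scale r
  obtain ⟨f, hf, hfs⟩ := scale s
  refine (((h.smul_y he).smul_z hf).change_b 0 (mul_ne_zero he hf)).hasMonomialSpan
    (.inr <| .inl hxx) (.inl ?_) (.inl ?_) (her.imp ?_ fun h' => .inl ?_) (.inr <| .inr ?_)
    (hfs.imp ?_ fun h' => .inl ?_)
  · linear_combination 𝒞 e * hxy
  · linear_combination 𝒞 f * hxz
  · intro h'
    replace h' := congrArg 𝒞 h'
    simp only [map_mul, map_zero] at h'
    linear_combination 𝒞 e * 𝒞 e * hyy + a * h'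
  · replace h' := congrArg 𝒞 h'
    simp only [map_mul, map_one] at h'
    linear_combination 𝒞 e * 𝒞 e * hyy + a * h'
  · simp only [map_mul, map_zero]
    linear_combination 𝒞 e * 𝒞 f * hyz
  · intro h'
    replace h' := congrArg 𝒞 h'
    simp only [map_mul, map_zero] at h'
    linear_combination 𝒞 f * 𝒞 f * hzz + a * h'
  · replace h' := congrArg 𝒞 h'
    simp only [map_mul, map_one] at h'
    linear_combination 𝒞 f * 𝒞 f * hzz + a * h'

theorem hasMonomialSpan_of_yz_mem (h : SocleFrame N x y z a b) (hxx : x * x = a)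
    (hxy : x * y = 0) (hxz : x * z = 0) {r s : F} (hyy : y * y = 𝒞 r * a)
    (hyz : y * z = 𝒞 s * a) (hzz : z * z = b) : HasMonomialSpan N 5 := by
  rcases eq_or_ne r 0 with rfl | hr
  · rcases eq_or_ne s 0 with rfl | hs
    · exact h.hasMonomialSpan (.inr <| .inl hxx) (.inl hxy) (.inl hxz)
        (.inl (by simpa using hyy)) (.inl (by simpa using hyz)) (.inr <| .inr hzz)
    · refine (h.smul_y (inv_ne_zero hs)).hasMonomialSpan (.inr <| .inl hxx) (.inl ?_) (.inl hxz)
        (.inl ?_) (.inr <| .inl ?_) (.inr <| .inr hzz)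
      · linear_combination 𝒞 s⁻¹ * hxy
      · simp only [map_zero, zero_mul] at hyy
        linear_combination 𝒞 s⁻¹ ^ 2 * hyy
      · linear_combination 𝒞 s⁻¹ * hyz + a * algebraMap_mul_algebraMap_inv (R := R) hs
  · obtain ⟨e, he, her⟩ := exists_mul_self_mul_eq_one hr
    replace her := congrArg 𝒞 her
    simp only [map_mul, map_one] at her
    have hi := algebraMap_mul_algebraMap_inv (R := R) hr
    refine (((h.change_b (-(s * s * r⁻¹)) one_ne_zero).add_zy (-(r⁻¹ * s))).smul_y
      he).hasMonomialSpan (.inr <| .inl hxx) (.inl ?_) (.inl ?_) (.inr <| .inl ?_)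
      (.inl ?_) (.inr <| .inr ?_) <;> try simp only [map_neg, map_mul, map_one]
    · linear_combination 𝒞 e * hxy
    · linear_combination hxz - 𝒞 r⁻¹ * 𝒞 s * hxy
    · linear_combination 𝒞 e * 𝒞 e * hyy + a * her
    · linear_combination 𝒞 e * hyz - 𝒞 e * 𝒞 r⁻¹ * 𝒞 s * hyy - 𝒞 e * 𝒞 s * a * hi
    · linear_combination hzz - 2 * 𝒞 r⁻¹ * 𝒞 s * hyz + 𝒞 r⁻¹ ^ 2 * 𝒞 s ^ 2 * hyy
        + 𝒞 r⁻¹ * 𝒞 s ^ 2 * a * hi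

variable [CharZero F]

theorem hasMonomialSpan_of_yy_mem (h : SocleFrame N x y z a b) (hxx : x * x = a)
    (hxy : x * y = 0) (hxz : x * z = 0) {p₁ p₂ q₂ p₃ q₃ : F}
    (hyy : y * y = 𝒞 p₁ * a) (hyz : y * z = 𝒞 p₂ * a + 𝒞 q₂ * b)
    (hzz : z * z = 𝒞 p₃ * a + 𝒞 q₃ * b) (hq : ¬ (q₂ = 0 ∧ q₃ = 0)) :
    HasMonomialSpan N 5 := by
  rcases ne_or_eq q₂ 0 with h₂ | rfl
  · obtain ⟨g, hg⟩ : ∃ g : F, 2 * g * q₂ = -q₃ := ⟨-q₃ / (2 * q₂), by field_simp⟩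
    replace hg := congrArg 𝒞 hg
    simp only [map_mul, map_ofNat, map_neg] at hg
    refine ((h.change_b (p₂ + g * p₁) h₂).add_zy g).hasMonomialSpan_of_square_scalars
      (s := p₃ + 2 * g * p₂ + g * g * p₁) hxx hxy ?_ hyy ?_ ?_ <;>
      try simp only [map_add, map_mul, map_ofNat]
    · linear_combination hxz + 𝒞 g * hxy
    · linear_combination hyz + 𝒞 g * hyy
    · linear_combination hzz + 2 * 𝒞 g * hyz + 𝒞 g ^ 2 * hyy + b * hg
  · have h₃ : q₃ ≠ 0 := fun h => hq ⟨rfl, h⟩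
    exact (h.change_b p₃ h₃).hasMonomialSpan_of_yz_mem hxx hxy hxz hyy (by simpa using hyz) hzz

theorem hasMonomialSpan_of_xx_eq (h : SocleFrame N x y z a b) (hxx : x * x = a)
    (hxy : x * y = 0) (hxz : x * z = 0) {p₁ q₁ p₂ q₂ p₃ q₃ : F}
    (hyy : y * y = 𝒞 p₁ * a + 𝒞 q₁ * b) (hyz : y * z = 𝒞 p₂ * a + 𝒞 q₂ * b)
    (hzz : z * z = 𝒞 p₃ * a + 𝒞 q₃ * b) (hq : ¬ (q₁ = 0 ∧ q₂ = 0 ∧ q₃ = 0)) :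
    HasMonomialSpan N 5 := by
  rcases eq_or_ne q₁ 0 with rfl | h₁
  · exact h.hasMonomialSpan_of_yy_mem hxx hxy hxz (by simpa using hyy) hyz hzz (by simpa using hq)
  · obtain ⟨t, ht⟩ := exists_quadratic_root h₁ (2 * q₂) q₃
    replace ht := congrArg 𝒞 ht
    simp only [map_mul, map_ofNat, map_add, map_zero] at ht
    refine (h.add_zy t).swap.hasMonomialSpan_of_yy_mem
      (p₁ := p₃ + 2 * t * p₂ + t * t * p₁) (p₂ := p₂ + t * p₁) (q₂ := q₂ + t * q₁)
      hxx ?_ hxy ?_ ?_ hyy (fun h => h₁ h.2) <;>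
      try simp only [map_add, map_mul, map_ofNat]
    · linear_combination hxz + 𝒞 t * hxy
    · linear_combination hzz + 2 * 𝒞 t * hyz + 𝒞 t ^ 2 * hyy + b * ht
    · linear_combination hyz + 𝒞 t * hyy

end Idempotent

/-- The multiplication by `x` has rank one. -/
theorem hasMonomialSpan_of_rank_one [IsAlgClosed F] [CharZero F] (h : SocleFrame N x y z a b)
    {c₁ c₂ c₃ p₁ q₁ p₂ q₂ p₃ q₃ : F}
    (hxx : x * x = 𝒞 c₁ * a) (hxy : x * y = 𝒞 c₂ * a) (hxz : x * z = 𝒞 c₃ * a)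
    (hyy : y * y = 𝒞 p₁ * a + 𝒞 q₁ * b) (hyz : y * z = 𝒞 p₂ * a + 𝒞 q₂ * b)
    (hzz : z * z = 𝒞 p₃ * a + 𝒞 q₃ * b) (hq : ¬ (q₁ = 0 ∧ q₂ = 0 ∧ q₃ = 0))
    (hc : ¬ (c₁ = 0 ∧ c₂ = 0 ∧ c₃ = 0)) :
    HasMonomialSpan N 5 := by
  rcases ne_or_eq c₁ 0 with h₁ | rfl
  · have hi := algebraMap_mul_algebraMap_inv (R := R) h₁
    refine (((h.smul_a h₁).add_yx (-(c₁⁻¹ * c₂))).add_zx (-(c₁⁻¹ * c₃))).hasMonomialSpan_of_xx_eq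
      (p₁ := c₁⁻¹ * (p₁ - c₁⁻¹ * c₂ * c₂)) (p₂ := c₁⁻¹ * (p₂ - c₁⁻¹ * c₂ * c₃))
      (p₃ := c₁⁻¹ * (p₃ - c₁⁻¹ * c₃ * c₃)) hxx ?_ ?_ ?_ ?_ ?_ hq <;>
      simp only [map_neg, map_mul, map_sub]
    · linear_combination hxy - 𝒞 c₁⁻¹ * 𝒞 c₂ * hxx - 𝒞 c₂ * a * hi
    · linear_combination hxz - 𝒞 c₁⁻¹ * 𝒞 c₃ * hxx - 𝒞 c₃ * a * hi
    · linear_combination hyy - 2 * 𝒞 c₁⁻¹ * 𝒞 c₂ * hxy + 𝒞 c₁⁻¹ ^ 2 * 𝒞 c₂ ^ 2 * hxx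
        - (𝒞 p₁ - 2 * 𝒞 c₁⁻¹ * 𝒞 c₂ * 𝒞 c₂) * a * hi
    · linear_combination hyz - 𝒞 c₁⁻¹ * 𝒞 c₂ * hxz - 𝒞 c₁⁻¹ * 𝒞 c₃ * hxy
        + 𝒞 c₁⁻¹ ^ 2 * 𝒞 c₂ * 𝒞 c₃ * hxx
        - (𝒞 p₂ - 2 * 𝒞 c₁⁻¹ * 𝒞 c₂ * 𝒞 c₃) * a * hi
    · linear_combination hzz - 2 * 𝒞 c₁⁻¹ * 𝒞 c₃ * hxz + 𝒞 c₁⁻¹ ^ 2 * 𝒞 c₃ ^ 2 * hxx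
        - (𝒞 p₃ - 2 * 𝒞 c₁⁻¹ * 𝒞 c₃ * 𝒞 c₃) * a * hi
  replace hxx : x * x = 0 := by simpa using hxx
  rcases ne_or_eq c₃ 0 with h₃ | rfl
  · have hi := algebraMap_mul_algebraMap_inv (R := R) h₃
    refine ((h.smul_a h₃).add_yz (-(c₃⁻¹ * c₂))).hasMonomialSpan_of_xx_eq_zero
      (p₁ := c₃⁻¹ * (p₁ - 2 * (c₃⁻¹ * c₂) * p₂ + (c₃⁻¹ * c₂) ^ 2 * p₃))
      (q₁ := q₁ - 2 * (c₃⁻¹ * c₂) * q₂ + (c₃⁻¹ * c₂) ^ 2 * q₃)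
      (p₂ := c₃⁻¹ * (p₂ - c₃⁻¹ * c₂ * p₃)) (q₂ := q₂ - c₃⁻¹ * c₂ * q₃)
      (p₃ := c₃⁻¹ * p₃) (q₃ := q₃) hxx ?_ hxz ?_ ?_ ?_ ?_
    · simp only [map_neg, map_mul]
      linear_combination hxy - 𝒞 c₃⁻¹ * 𝒞 c₂ * hxz - 𝒞 c₂ * a * hi
    · simp only [map_neg, map_mul, map_sub, map_add, map_pow, map_ofNat]
      linear_combination hyy - 2 * 𝒞 c₃⁻¹ * 𝒞 c₂ * hyz + (𝒞 c₃⁻¹ * 𝒞 c₂) ^ 2 * hzz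
        - (𝒞 p₁ - 2 * (𝒞 c₃⁻¹ * 𝒞 c₂) * 𝒞 p₂ + (𝒞 c₃⁻¹ * 𝒞 c₂) ^ 2 * 𝒞 p₃) * a * hi
    · simp only [map_neg, map_mul, map_sub]
      linear_combination hyz - 𝒞 c₃⁻¹ * 𝒞 c₂ * hzz
        - (𝒞 p₂ - (𝒞 c₃⁻¹ * 𝒞 c₂) * 𝒞 p₃) * a * hi
    · simp only [map_mul]
      linear_combination hzz - 𝒞 p₃ * a * hi
    · rintro ⟨h1, h2, rfl⟩
      obtain rfl : q₂ = 0 := by simpa using h2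
      exact hq ⟨by simpa using h1, rfl, rfl⟩
  · have h₂ : c₂ ≠ 0 := fun h => hc ⟨rfl, h, rfl⟩
    have hi := algebraMap_mul_algebraMap_inv (R := R) h₂
    refine (h.smul_a h₂).swap.hasMonomialSpan_of_xx_eq_zero (p₁ := c₂⁻¹ * p₃) (q₁ := q₃)
      (p₂ := c₂⁻¹ * p₂) (q₂ := q₂) (p₃ := c₂⁻¹ * p₁) (q₃ := q₁) hxx (by simpa using hxz) hxy
      ?_ ?_ ?_ (fun h => hq ⟨h.2.2, h.2.1, h.1⟩) <;> simp only [map_mul]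
    · linear_combination hzz - 𝒞 p₃ * a * hi
    · linear_combination hyz - 𝒞 p₂ * a * hi
    · linear_combination hyy - 𝒞 p₁ * a * hi

end SocleFrame

end Pencil

section Filtration

open scoped Pointwise

variable {F R : Type*} [Field F] [CommRing R] [Algebra F R]

theorem Submodule.le_of_le_sup_mul {N P Q M : Submodule F R} {k : ℕ} (hN : N ^ k = ⊥) (hM : M ≤ N)
    (hP : P ≤ Q ⊔ P * M) (hQ : Q * M ≤ Q) : P ≤ Q := by
  have hQ' : ∀ i, Q * M ^ i ≤ Q := by
    intro i
    induction i with
    | zero => simp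
    | succ i ih =>
      rw [pow_succ, ← mul_assoc]
      exact (mul_le_mul_left ih M).trans hQ
  have key : ∀ i, P ≤ Q ⊔ P * M ^ i := by
    intro i
    induction i with
    | zero => simp
    | succ i ih =>
      refine ih.trans (sup_le le_sup_left ?_)
      refine (mul_le_mul_left hP (M ^ i)).trans ?_
      rw [Submodule.sup_mul, mul_assoc, ← pow_succ']
      exact sup_le_sup_right (hQ' i) _
  have h0 : M ^ k = ⊥ := le_bot_iff.1 ((pow_le_pow_left' hM k).trans hN.le)
  simpa [h0] using key k

theorem Submodule.eq_bot_of_le_mul {N P : Submodule F R} {k : ℕ} (hN : N ^ k = ⊥)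
    (hP : P ≤ P * N) : P = ⊥ :=
  le_bot_iff.1 <| le_of_le_sup_mul hN le_rfl (by simpa using hP) (by simp)

theorem Submodule.mul_le_span_sup {A A' N N' : Submodule F R} {S T : Set R}
    (hS : S ⊆ A) (hA : A ≤ span F S ⊔ A') (hN : N ≤ span F T ⊔ N') :
    A * N ≤ span F (S * T) ⊔ (A * N' ⊔ A' * N) := by
  refine (mul_le_mul_left hA N).trans ?_
  rw [Submodule.sup_mul]
  refine sup_le ?_ (le_sup_right.trans le_sup_right)
  refine (mul_le_mul_right hN (span F S)).trans ?_
  rw [Submodule.mul_sup, span_mul_span]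
  exact sup_le_sup_left ((mul_le_mul_left (span_le.2 hS) N').trans le_sup_left) _

variable [FiniteDimensional F R]

theorem Submodule.exists_le_span_sup {A B : Submodule F R} (n : ℕ) (hBA : B ≤ A)
    (h : Module.finrank F A ≤ Module.finrank F B + n) :
    ∃ v : Fin n → R, (∀ i, v i ∈ A) ∧ A ≤ span F (Set.range v) ⊔ B := by
  induction n generalizing B with
  | zero =>
    refine ⟨Fin.elim0, fun i => i.elim0, ?_⟩
    rw [eq_of_le_of_finrank_le hBA h]
    exact le_sup_right
  | succ n ih =>
    by_cases hAB : A ≤ B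
    · exact ⟨0, by simp, hAB.trans le_sup_right⟩
    obtain ⟨w, hwA, hwB⟩ := SetLike.not_le_iff_exists.1 hAB
    have hlt : B < span F {w} ⊔ B := by
      refine lt_of_le_of_ne le_sup_right fun he => hwB ?_
      rw [he]
      exact mem_sup_left (mem_span_singleton_self w)
    have := Submodule.finrank_lt_finrank_of_lt hlt
    obtain ⟨v, hv, hA⟩ := ih (B := span F {w} ⊔ B) (sup_le (by simpa using hwA) hBA)
      (by omega)
    refine ⟨Fin.cons w v, Fin.cases hwA hv, hA.trans ?_⟩
    rw [Fin.range_cons, span_insert, sup_assoc, sup_left_comm]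

theorem Submodule.exists_sum_smul_mem {A B : Submodule F R} {n m : ℕ} (hBA : B ≤ A)
    (h : Module.finrank F A ≤ Module.finrank F B + n) (hnm : n < m) {v : Fin m → R}
    (hv : ∀ i, v i ∈ A) : ∃ g : Fin m → F, g ≠ 0 ∧ ∑ i, g i • v i ∈ B := by
  obtain ⟨w, -, hA⟩ := exists_le_span_sup n hBA h
  have hle : span F (Set.range fun i => B.mkQ (v i)) ≤
      span F (Set.range fun i => B.mkQ (w i)) := by
    rw [span_le, Set.range_subset_iff]
    intro i
    obtain ⟨y, hy, z, hz, hyz⟩ := mem_sup.1 (hA (hv i))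
    have : B.mkQ (v i) = B.mkQ y := by
      rw [← hyz, map_add, mkQ_apply B z, (Submodule.Quotient.mk_eq_zero B).2 hz, add_zero]
    rw [SetLike.mem_coe, this, Set.range_comp' B.mkQ w, span_image]
    exact mem_map_of_mem hy
  have hli : ¬ LinearIndependent F fun i => B.mkQ (v i) := by
    intro hli
    have h1 := finrank_span_eq_card hli
    have h2 := Submodule.finrank_mono hle
    have h3 := finrank_range_le_card (R := F) fun i => B.mkQ (w i)
    simp only [Fintype.card_fin, Set.finrank] at h1 h3
    omega
  obtain ⟨g, hg, i, hi⟩ := Fintype.not_linearIndependent_iff.1 hli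
  refine ⟨g, fun h => hi (congrFun h i), ?_⟩
  rw [← Submodule.Quotient.mk_eq_zero, ← mkQ_apply]
  simpa using hg

theorem linearIndependent_pow_of_ne_zero {K A : Type*} [Field K] [Ring A] [Algebra K A] {x : A}
    {r : ℕ} (hr : x ^ r ≠ 0) (hr' : x ^ (r + 1) = 0) :
    LinearIndependent K fun i : Fin (r + 1) => x ^ (i : ℕ) := by
  have hx : IsIntegral K x := ⟨.X ^ (r + 1), Polynomial.monic_X_pow _, by simp [hr']⟩
  obtain ⟨k, -, hk⟩ := (dvd_prime_pow Polynomial.prime_X _).1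
    (minpoly.dvd K x (p := .X ^ (r + 1)) (by simp [hr']))
  have hmin := Polynomial.eq_of_monic_of_associated (minpoly.monic hx)
    (Polynomial.monic_X_pow k) hk
  have hxk : x ^ k = 0 := by simpa [hmin] using minpoly.aeval K x
  have hrk : r + 1 ≤ (minpoly K x).natDegree := by
    rw [hmin, Polynomial.natDegree_X_pow]
    by_contra! h
    exact hr (pow_eq_zero_of_le (by omega) hxk)
  exact (linearIndependent_pow x).comp (Fin.castLE hrk) (Fin.castLE_injective hrk)

theorem finrank_map_mulLeft_add (x : R) (A : Submodule F R) :
    Module.finrank F (A.map (LinearMap.mulLeft F x)) +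
      Module.finrank F ↥(A ⊓ (LinearMap.mulLeft F x).ker) = Module.finrank F A := by
  rw [← LinearMap.finrank_range_add_finrank_ker ((LinearMap.mulLeft F x).domRestrict A),
    LinearMap.range_domRestrict, LinearMap.ker_domRestrict, ← finrank_map_subtype_eq,
    Submodule.map_comap_subtype]

/-- A symmetric multiplication with values in a line can be diagonalised. -/
theorem Submodule.exists_orthogonal_span [IsAlgClosed F] [CharZero F] {K : Submodule F R} {t : R}
    (ht : t ≠ 0) (hK : ∀ u ∈ K, ∀ v ∈ K, u * v ∈ span F {t}) :
    ∃ e : Fin (Module.finrank F K) → R, (∀ i, e i ∈ K) ∧ K ≤ span F (Set.range e) ∧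
      ∀ i j, e i * e j = 0 ∨ e i * e j = t := by
  obtain ⟨f, hf⟩ := Module.Projective.exists_dual_eq_one F ht
  have hft : ∀ u ∈ K, ∀ v ∈ K, u * v = f (u * v) • t := by
    intro u hu v hv
    obtain ⟨c, hc⟩ := mem_span_singleton.1 (hK u hu v hv)
    rw [← hc, map_smul, hf, smul_eq_mul, mul_one]
  let B : LinearMap.BilinForm F K :=
    LinearMap.BilinForm.restrict ((LinearMap.mul F R).compr₂ f) K
  have hB : ∀ u v : K, B u v = f (u * v) := fun u v => rfl
  have hsymm : LinearMap.IsSymm B := ⟨fun u v => by simp [hB, mul_comm]⟩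
  have : Invertible (2 : F) := invertibleOfNonzero two_ne_zero
  obtain ⟨v, hv⟩ := LinearMap.BilinForm.exists_orthogonal_basis hsymm
  have hsq : ∀ i, ∃ k : F, k ≠ 0 ∧ (k * k * B (v i) (v i) = 0 ∨ k * k * B (v i) (v i) = 1) := by
    intro i
    rcases eq_or_ne (B (v i) (v i)) 0 with h | h
    · exact ⟨1, one_ne_zero, .inl (by simp [h])⟩
    · obtain ⟨k, hk, hk'⟩ := exists_mul_self_mul_eq_one h
      exact ⟨k, hk, .inr hk'⟩
  choose k hk hkk using hsq
  refine ⟨fun i => k i • (v i : R), fun i => K.smul_mem _ (v i).2, ?_, fun i j => ?_⟩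
  · intro u hu
    rw [show u = ((⟨u, hu⟩ : K) : R) from rfl, ← v.sum_repr ⟨u, hu⟩]
    rw [AddSubmonoidClass.coe_finsetSum]
    refine sum_mem fun i _ => ?_
    rw [coe_smul, show (v i : R) = (k i)⁻¹ • k i • (v i : R) by
      rw [smul_smul, inv_mul_cancel₀ (hk i), one_smul]]
    exact smul_mem _ _ (smul_mem _ _ (subset_span ⟨i, rfl⟩))
  · have h1 : k i • (v i : R) * k j • (v j : R) = (k i * k j * B (v i) (v j)) • t := by
      rw [smul_mul_smul_comm, hft _ (v i).2 _ (v j).2, smul_smul, hB]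
    simp only [h1]
    rcases eq_or_ne i j with rfl | hij
    · exact (hkk i).imp (fun h => by simp [h]) (fun h => by simp [h])
    · have : B (v i) (v j) = 0 := hv hij
      simp [this]

end Filtration

section Chain

variable {F R : Type*} [Field F] [CommRing R] [Algebra F R] [FiniteDimensional F R]

theorem HasMonomialSpan.of_mul_self_eq_bot {N : Submodule F R} (h : N * N = ⊥) :
    HasMonomialSpan N (Module.finrank F N) := by
  classical
  obtain ⟨v, hv, hN⟩ := exists_le_span_sup (A := N) (B := ⊥) (Module.finrank F N) bot_le
    (by simp)
  refine ⟨Finset.univ.image v, Finset.card_image_le.trans (by simp), by simpa using hN, ?_⟩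
  intro a ha b hb
  simp only [Finset.mem_image, Finset.mem_univ, true_and] at ha hb
  obtain ⟨i, rfl⟩ := ha
  obtain ⟨j, rfl⟩ := hb
  exact .inl ((mem_bot F).1 (h ▸ mul_mem_mul (hv i) (hv j)))

variable [IsAlgClosed F] [CharZero F]

omit [FiniteDimensional F R] [IsAlgClosed F] in
theorem exists_mul_self_notMem {N P : Submodule F R} (h : ¬ N * N ≤ P) :
    ∃ x ∈ N, x * x ∉ P := by
  by_contra! hx
  refine h (mul_le.2 fun u hu v hv => ?_)
  have h2 : u * v = (2⁻¹ : F) • ((u + v) * (u + v) - u * u - v * v) := by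
    rw [show (u + v) * (u + v) - u * u - v * v = (2 : F) • (u * v) by
      rw [two_smul]; ring, smul_smul, inv_mul_cancel₀ two_ne_zero, one_smul]
  rw [h2]
  exact P.smul_mem _ (sub_mem (sub_mem (hx _ (add_mem hu hv)) (hx _ hu)) (hx _ hv))

theorem HasMonomialSpan.of_finrank_mul_self_le {N : Submodule F R} {k : ℕ} (hNN : N * N ≤ N)
    (hk : N ^ k = ⊥)
    (hd : Module.finrank F ↥(N * N) ≤ Module.finrank F ↥(N * N * N) + 1) :
    HasMonomialSpan N (Module.finrank F N) := by
  classical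
  by_cases hN2 : N * N = ⊥
  · exact .of_mul_self_eq_bot hN2
  have h32 : N * N * N ≤ N * N := mul_le_mul_left hNN N
  obtain ⟨x, hx, hxx⟩ : ∃ x ∈ N, x * x ∉ N * N * N :=
    exists_mul_self_notMem fun h => hN2 (eq_bot_of_le_mul hk h)
  -- the square and the cube of `N` in terms of `x`
  have hXN : span F {x} ≤ N := by simpa using hx
  have hsq : N * N ≤ span F {x * x} ⊔ N * N * N := by
    have hlt : N * N * N < span F {x * x} ⊔ N * N * N := by
      refine lt_of_le_of_ne le_sup_right fun he => hxx ?_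
      rw [he]
      exact mem_sup_left (mem_span_singleton_self _)
    have hle : span F {x * x} ⊔ N * N * N ≤ N * N :=
      sup_le (by simpa using mul_mem_mul hx hx) h32
    have := Submodule.finrank_lt_finrank_of_lt hlt
    exact (eq_of_le_of_finrank_le hle (by omega)).ge
  have hxx' : span F {x * x} ≤ span F {x} * N := by
    simpa [mem_span_singleton_mul] using ⟨x, hx, rfl⟩
  have h2 : N * N ≤ span F {x} * N := by
    refine le_of_le_sup_mul hk le_rfl (hsq.trans (sup_le_sup_right hxx' _)) ?_
    rw [mul_assoc]
    exact mul_le_mul_right hNN _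
  have h3 : N * N * N ≤ span F {x} * (N * N) := by
    rw [← mul_assoc]
    exact mul_le_mul_left h2 N
  have hmap : ∀ P : Submodule F R, span F {x} * P = P.map (LinearMap.mulLeft F x) := by
    intro P
    ext y
    simp [mem_span_singleton_mul]
  -- powers of `x`
  have hpow : ∀ n, x ^ (n + 1) ∈ N := by
    intro n
    induction n with
    | zero => simpa using hx
    | succ n ih => rw [pow_succ]; exact hNN (mul_mem_mul ih hx)
  have hpow2 : ∀ n, x ^ (n + 2) ∈ N * N := fun n => by
    rw [pow_succ]; exact mul_mem_mul (hpow n) hx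
  have hex : ∃ n, x ^ n = 0 := ⟨k, by
    have := pow_mem_pow N hx k
    rwa [hk, mem_bot] at this⟩
  obtain ⟨r, hr, hr0⟩ : ∃ r, x ^ (r + 2) ≠ 0 ∧ x ^ (r + 2 + 1) = 0 := by
    have h0 := Nat.find_spec hex
    have hmin : ∀ m < Nat.find hex, x ^ m ≠ 0 := fun m hm => Nat.find_min hex hm
    have h2 : 2 < Nat.find hex := by
      by_contra! hle
      refine hxx ?_
      rw [← pow_two x, pow_eq_zero_of_le hle h0]
      exact zero_mem _
    refine ⟨Nat.find hex - 3, hmin _ (by omega), ?_⟩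
    rw [show Nat.find hex - 3 + 2 + 1 = Nat.find hex by omega]
    exact h0
  set t := x ^ (r + 2) with ht
  have hxt : x * t = 0 := by rw [ht, ← pow_succ', hr0]
  have hann : N * N ⊓ (LinearMap.mulLeft F x).ker ≤ span F {t} := by
    have h1 := finrank_map_mulLeft_add x (N * N)
    have h4 : Module.finrank F ↥(N * N * N) ≤
        Module.finrank F ↥((N * N).map (LinearMap.mulLeft F x)) := by
      rw [← hmap]; exact Submodule.finrank_mono h3
    refine (eq_of_le_of_finrank_le (S₁ := span F {t}) ?_ ?_).ge
    · simpa [hxt] using hpow2 r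
    · rw [finrank_span_singleton hr]; omega
  -- the annihilator of `x`, split as the line of `t` and a complement
  set K := N ⊓ (LinearMap.mulLeft F x).ker with hK
  have htK : span F {t} ≤ K := by
    simpa [hK, hxt] using hpow (r + 1)
  obtain ⟨C, hC⟩ := (span F {t}).exists_isCompl
  have hKC : span F {t} ⊔ (C ⊓ K) = K := by
    rw [← sup_inf_assoc_of_le _ htK, hC.sup_eq_top, top_inf_eq]
  obtain ⟨e, heK, heC, hee⟩ := exists_orthogonal_span (K := C ⊓ K) hr (fun u hu v hv => by
    refine hann ⟨mul_mem_mul hu.2.1 hv.2.1, ?_⟩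
    have hxu : x * u = 0 := hu.2.2
    change x * (u * v) = 0
    rw [← mul_assoc, hxu, zero_mul])
  have hxe : ∀ i, x * e i = 0 := fun i => by
    simpa using (heK i).2.2
  set s : Finset R :=
    (Finset.range (r + 2)).image (fun i => x ^ (i + 1)) ∪ Finset.univ.image e with hs
  have hxs : ∀ i, x ^ (i + 1) = 0 ∨ x ^ (i + 1) ∈ s := by
    intro i
    rcases lt_or_ge i (r + 2) with hi | hi
    · exact .inr (Finset.mem_union_left _
        (Finset.mem_image_of_mem (fun i => x ^ (i + 1)) (Finset.mem_range.2 hi)))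
    · exact .inl (pow_eq_zero_of_le (by omega) hr0)
  have hxspan : ∀ i, x ^ (i + 1) ∈ span F (s : Set R) := fun i =>
    (hxs i).elim (fun h => h ▸ zero_mem _) fun h => subset_span h
  refine ⟨s, ?_, ?_, ?_⟩
  · have hli := (linearIndependent_pow_of_ne_zero (K := F) hr hr0).comp
      (fun i : Fin (r + 1) => (⟨i + 2, by omega⟩ : Fin (r + 2 + 1)))
      (fun i j hij => by simpa [Fin.ext_iff] using hij)
    have h5 := finrank_span_eq_card hli
    have h6 : span F (Set.range fun i : Fin (r + 1) => x ^ ((i : ℕ) + 2)) ≤ N * N := by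
      rw [span_le, Set.range_subset_iff]
      exact fun i => hpow2 i
    have h7 := Submodule.finrank_mono h6
    have h8 := finrank_map_mulLeft_add x N
    have h9 := Submodule.finrank_mono (h2.trans (hmap N).le)
    have h10 := finrank_sup_add_finrank_inf_eq (span F {t}) (C ⊓ K)
    rw [hKC, finrank_span_singleton hr, ← inf_assoc, hC.inf_eq_bot, bot_inf_eq,
      finrank_bot] at h10
    have h11 : s.card ≤ (r + 2) + Module.finrank F ↥(C ⊓ K) := by
      refine (Finset.card_union_le _ _).trans (add_le_add ?_ ?_)
      · exact Finset.card_image_le.trans (by simp)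
      · exact Finset.card_image_le.trans (by simp)
    simp only [Fintype.card_fin, Function.comp_def] at h5
    rw [← hK] at h8
    omega
  · set W := span F (Set.range fun i : ℕ => x ^ (i + 1)) with hW
    have hWs : W ≤ span F (s : Set R) := by
      rw [hW, span_le, Set.range_subset_iff]
      exact hxspan
    have hWX : span F {x} * W ≤ W := by
      rw [hW, span_mul_span, span_le]
      rintro _ ⟨_, rfl, _, ⟨i, rfl⟩, rfl⟩
      exact subset_span ⟨i + 1, by simp [pow_succ']⟩
    have h2W : N * N ≤ span F {x} * W := by
      refine le_of_le_sup_mul hk hXN (hsq.trans (sup_le_sup ?_ (h3.trans (mul_comm _ _).le))) ?_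
      · rw [span_singleton_le_iff_mem, mem_span_singleton_mul]
        exact ⟨x, subset_span ⟨0, by simp⟩, rfl⟩
      · rw [mul_assoc, mul_comm W]
        exact mul_le_mul_right hWX _
    intro v hv
    obtain ⟨p, hp, hpv⟩ := mem_span_singleton_mul.1 (h2W (mul_mem_mul hx hv))
    have hpN : p ∈ N := by
      have : W ≤ N := by
        rw [hW, span_le, Set.range_subset_iff]
        exact hpow
      exact this hp
    have hKs : K ≤ span F (s : Set R) := by
      rw [← hKC]
      refine sup_le ?_ (heC.trans (span_mono ?_))
      · rw [span_singleton_le_iff_mem]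
        exact hxspan _
      · rintro _ ⟨i, rfl⟩
        simp [hs]
    have hvK : v - p ∈ K := ⟨sub_mem hv hpN, by simp [mul_sub, hpv]⟩
    simpa using add_mem (hKs hvK) (hWs hp)
  · have hts : t ∈ s := (hxs (r + 1)).resolve_left hr
    intro u hu v hv
    simp only [hs, Finset.mem_union, Finset.mem_image, Finset.mem_range, Finset.mem_univ,
      true_and] at hu hv
    rcases hu with ⟨i, -, rfl⟩ | ⟨i, rfl⟩ <;> rcases hv with ⟨j, -, rfl⟩ | ⟨j, rfl⟩
    · rw [← pow_add, ← add_assoc]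
      exact hxs _
    · left
      rw [pow_succ, mul_assoc, hxe, mul_zero]
    · left
      rw [pow_succ', ← mul_assoc, mul_comm (e i), hxe, zero_mul]
    · exact (hee i j).imp_right fun (h : e i * e j = t) => h ▸ hts

end Chain

section TwoGenerators

variable {F R : Type*} [Field F] [CommRing R] [Algebra F R]

local notation "𝒞" => algebraMap F R

theorem HasMonomialSpan.of_five_mul {N : Submodule F R} {x y z a b : R}
    (hN : N ≤ span F ({x, y, z, a, b} : Set R)) {s : Set R} (hs : s = {x, y, z, a, b})
    (hxx : x * x = 0 ∨ x * x ∈ s) (hxy : x * y = 0 ∨ x * y ∈ s) (hxz : x * z = 0 ∨ x * z ∈ s)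
    (hxa : x * a = 0 ∨ x * a ∈ s) (hxb : x * b = 0 ∨ x * b ∈ s) (hyy : y * y = 0 ∨ y * y ∈ s)
    (hyz : y * z = 0 ∨ y * z ∈ s) (hya : y * a = 0 ∨ y * a ∈ s) (hyb : y * b = 0 ∨ y * b ∈ s)
    (hzz : z * z = 0 ∨ z * z ∈ s) (hza : z * a = 0 ∨ z * a ∈ s) (hzb : z * b = 0 ∨ z * b ∈ s)
    (haa : a * a = 0 ∨ a * a ∈ s) (hab : a * b = 0 ∨ a * b ∈ s) (hbb : b * b = 0 ∨ b * b ∈ s) :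
    HasMonomialSpan N 5 := by
  classical
  have hs' : s = (({x, y, z, a, b} : Finset R) : Set R) := by simp [hs]
  refine .of_five hN ?_
  simp only [← Finset.mem_coe, ← hs']
  rw [hs]
  rintro u (rfl | rfl | rfl | rfl | rfl) v (rfl | rfl | rfl | rfl | rfl) <;>
    rw [← hs] <;> first | assumption | (rw [mul_comm]; assumption)

theorem span_pair_mul_span_pair_le {x y : R} {p : Submodule F R} (hxx : x * x ∈ p)
    (hxy : x * y ∈ p) (hyy : y * y ∈ p) : span F {x, y} * span F {x, y} ≤ p := by
  rw [span_mul_span, span_le]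
  rintro _ ⟨u, (rfl | rfl), v, (rfl | rfl), rfl⟩
  · exact hxx
  · exact hxy
  · change u * v ∈ p
    rw [mul_comm]
    exact hxy
  · exact hyy

theorem span_pair_pow_three_le {x y : R} {p : Submodule F R} (hxxx : x * x * x ∈ p)
    (hxxy : x * x * y ∈ p) (hxyy : x * y * y ∈ p) (hyyy : y * y * y ∈ p) :
    span F {x, y} * span F {x, y} * span F {x, y} ≤ p := by
  rw [span_mul_span, span_mul_span, span_le]
  have h1 : x * y * x = x * x * y := by ring
  have h2 : y * x * x = x * x * y := by ring
  have h3 : y * x * y = x * y * y := by ring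
  have h4 : y * y * x = x * y * y := by ring
  rintro _ ⟨_, ⟨u, (rfl | rfl), v, (rfl | rfl), rfl⟩, w, (rfl | rfl), rfl⟩ <;>
    simpa [h1, h2, h3, h4]

theorem mem_span_two {x y v : R} :
    v ∈ span F ({x, y} : Set R) ↔ ∃ c₁ c₂ : F, v = 𝒞 c₁ * x + 𝒞 c₂ * y := by
  simp only [mem_span_pair, Algebra.smul_def, eq_comm]

theorem span_pair_eq {v w y z : R} (hv : v ∈ span F {y, z}) (hw : w ∈ span F {y, z})
    (hy : y ∈ span F {v, w}) (hz : z ∈ span F {v, w}) :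
    span F ({v, w} : Set R) = span F {y, z} := by
  apply le_antisymm <;> rw [span_le]
  · rintro _ (rfl | rfl) <;> assumption
  · rintro _ (rfl | rfl) <;> assumption

/-- A nonzero binary quadratic form is, after a change of coordinates, a multiple of `v * w` or of
`v * v`. -/
theorem exists_span_pair_eq_of_quadratic [IsAlgClosed F] [CharZero F] {α β γ : F}
    (h : ¬ (α = 0 ∧ β = 0 ∧ γ = 0)) (y z : R) :
    ∃ v w : R, span F ({v, w} : Set R) = span F {y, z} ∧ ∃ k : F, k ≠ 0 ∧
      (𝒞 α * (y * y) + 𝒞 β * (y * z) + 𝒞 γ * (z * z) = 𝒞 k * (v * w) ∨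
        𝒞 α * (y * y) + 𝒞 β * (y * z) + 𝒞 γ * (z * z) = 𝒞 k * (v * v)) := by
  rcases ne_or_eq α 0 with hα | rfl
  · obtain ⟨t, ht⟩ := exists_quadratic_root hα β γ
    obtain ⟨t', ht'⟩ : ∃ t', α * (t + t') = -β := ⟨-β / α - t, by field_simp; ring⟩
    have hγ : α * (t * t') = γ := by linear_combination t * ht' - ht
    rcases ne_or_eq t t' with hne | rfl
    · have hi := algebraMap_mul_algebraMap_inv (R := R) (sub_ne_zero.2 hne)
      replace ht' := congrArg 𝒞 ht'
      replace hγ := congrArg 𝒞 hγ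
      simp only [map_mul, map_add, map_neg, map_sub] at ht' hγ hi
      refine ⟨y - 𝒞 t * z, y - 𝒞 t' * z, span_pair_eq (mem_span_two.2 ⟨1, -t, ?_⟩)
        (mem_span_two.2 ⟨1, -t', ?_⟩)
        (mem_span_two.2 ⟨-((t - t')⁻¹ * t'), (t - t')⁻¹ * t, ?_⟩)
        (mem_span_two.2 ⟨-(t - t')⁻¹, (t - t')⁻¹, ?_⟩), α, hα, .inl ?_⟩
      · simp; ring
      · simp; ring
      · simp only [map_neg, map_mul]
        linear_combination -y * hi
      · simp only [map_neg]
        linear_combination -z * hi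
      · linear_combination y * z * ht' - z * z * hγ
    · replace ht' := congrArg 𝒞 ht'
      replace hγ := congrArg 𝒞 hγ
      simp only [map_mul, map_add, map_neg] at ht' hγ
      refine ⟨y - 𝒞 t * z, z, span_pair_eq (mem_span_two.2 ⟨1, -t, ?_⟩)
        (subset_span (by simp)) (mem_span_two.2 ⟨1, t, ?_⟩) (subset_span (by simp)),
        α, hα, .inr ?_⟩
      · simp; ring
      · simp
      · linear_combination y * z * ht' - z * z * hγ
  rcases ne_or_eq β 0 with hβ | rfl
  · have hi := algebraMap_mul_algebraMap_inv (R := R) hβ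
    refine ⟨z, 𝒞 β * y + 𝒞 γ * z, span_pair_eq (subset_span (by simp))
      (mem_span_two.2 ⟨β, γ, rfl⟩) (mem_span_two.2 ⟨-(β⁻¹ * γ), β⁻¹, ?_⟩)
      (subset_span (by simp)), 1, one_ne_zero, .inl ?_⟩
    · simp only [map_neg, map_mul]
      linear_combination -y * hi
    · simp; ring
  · exact ⟨z, y, by rw [Set.pair_comm], γ, fun h' => h ⟨rfl, rfl, h'⟩, .inr (by simp)⟩

section Cubic

variable {N : Submodule F R} {x y : R}

/-- Products of four elements vanish and `x * y = 0`. -/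
theorem HasMonomialSpan.of_mul_eq_zero (hx : x ∈ N) (hy : y ∈ N)
    (h4 : ∀ p ∈ N, ∀ q ∈ N, ∀ r ∈ N, ∀ s ∈ N, p * q * r * s = 0)
    (hN : N ≤ span F ({x, y, x * x, y * y, x * x * x} : Set R)) (hxy : x * y = 0)
    (hyyy : y * y * y = 0 ∨ y * y * y = x * x * x) : HasMonomialSpan N 5 := by
  have hxxxx := h4 x hx x hx x hx x hx
  have hyyyy := h4 y hy y hy y hy y hy
  refine .of_five_mul hN rfl (.inr (by simp)) (.inl hxy) (.inr (by simp [mul_assoc])) (.inl ?_)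
    (.inl ?_) (.inr (by simp)) (.inl ?_) (hyyy.imp ?_ fun h => ?_) (.inl ?_) (.inl ?_) (.inl ?_)
    (.inl ?_) (.inl ?_) (.inl ?_) (.inl ?_)
  · linear_combination y * hxy
  · linear_combination hxxxx
  · linear_combination x * hxy
  · intro h
    linear_combination h
  · rw [← mul_assoc, h]; simp
  · linear_combination x * x * hxy
  · linear_combination hxxxx
  · linear_combination x * y * hxy
  · linear_combination x * hxxxx
  · linear_combination hyyyy
  · linear_combination x * x * y * hxy
  · linear_combination x * x * hxxxx

variable [IsAlgClosed F] [CharZero F]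

omit [CharZero F] in
theorem HasMonomialSpan.of_mul_eq (hx : x ∈ N) (hy : y ∈ N)
    (h4 : ∀ p ∈ N, ∀ q ∈ N, ∀ r ∈ N, ∀ s ∈ N, p * q * r * s = 0)
    (hN : N ≤ span F ({x, y, x * x, y * y, x * x * x} : Set R)) {c e : F}
    (hxy : x * y = 𝒞 c * (x * x * x)) (hyyy : y * y * y = 𝒞 e * (x * x * x))
    (hxx : x * x ∈ N) : HasMonomialSpan N 5 := by
  have hxxxx := h4 x hx x hx x hx x hx
  obtain ⟨k, hk, hke⟩ : ∃ k : F, k ≠ 0 ∧ (k ^ 3 * e = 0 ∨ k ^ 3 * e = 1) := by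
    rcases eq_or_ne e 0 with rfl | he
    · exact ⟨1, one_ne_zero, .inl (by simp)⟩
    · obtain ⟨k, hk⟩ := IsAlgClosed.exists_pow_nat_eq e⁻¹ (n := 3) (by norm_num)
      refine ⟨k, ?_, .inr (by rw [hk, inv_mul_cancel₀ he])⟩
      rintro rfl
      exact inv_ne_zero he (by simpa using hk.symm)
  have hi := algebraMap_mul_algebraMap_inv (R := R) hk
  set y' := 𝒞 k * (y - 𝒞 c * (x * x)) with hy'
  have hyy' : y' * y' = 𝒞 k * 𝒞 k * (y * y) := by
    linear_combination 𝒞 k * 𝒞 k * (-2 * 𝒞 c * x * hxy - 𝒞 c * 𝒞 c * hxxxx)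
  have hyyy' : y' * y' * y' = 𝒞 k ^ 3 * (y * y * y) := by
    rw [hyy', hy']
    linear_combination -𝒞 k ^ 3 * 𝒞 c * (x * y * hxy + 𝒞 c * y * hxxxx)
  refine .of_mul_eq_zero (y := y') hx
    (algebraMap_mul_mem _ (sub_mem hy (algebraMap_mul_mem _ hxx))) h4 (hN.trans ?_) ?_ ?_
  · refine span_five_le (subset_span (by simp)) (mem_span_five.2 ⟨0, k⁻¹, c, 0, 0, ?_⟩)
      (subset_span (by simp)) (mem_span_five.2 ⟨0, 0, 0, k⁻¹ * k⁻¹, 0, ?_⟩)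
      (subset_span (by simp))
    · simp only [map_zero, hy']
      linear_combination -(y - 𝒞 c * (x * x)) * hi
    · simp only [map_zero, hyy', map_mul]
      linear_combination -(y * y) * (𝒞 k * 𝒞 k⁻¹ + 1) * hi
  · rw [hy']
    linear_combination 𝒞 k * hxy
  · rw [hyyy']
    refine hke.imp (fun h => ?_) (fun h => ?_)
    · replace h := congrArg 𝒞 h
      simp only [map_mul, map_pow, map_zero] at h
      linear_combination 𝒞 k ^ 3 * hyyy + x * x * x * h
    · replace h := congrArg 𝒞 h
      simp only [map_mul, map_pow, map_one] at h
      linear_combination 𝒞 k ^ 3 * hyyy + x * x * x * h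

omit [IsAlgClosed F] in
/-- Products of four elements vanish and `x * x * y` spans the cube. -/
theorem HasMonomialSpan.of_mul_self_eq (hx : x ∈ N) (hy : y ∈ N)
    (h4 : ∀ p ∈ N, ∀ q ∈ N, ∀ r ∈ N, ∀ s ∈ N, p * q * r * s = 0)
    (hN : N ≤ span F ({x, y, x * x, x * y, x * x * y} : Set R)) {c e : F}
    (hyy : y * y = 𝒞 c * (x * x * y)) (hxxx : x * x * x = 𝒞 e * (x * x * y)) :
    HasMonomialSpan N 5 := by
  have hxxxx := h4 x hx x hx x hx x hx
  have hxxxy := h4 x hx x hx x hx y hy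
  have hxxyy := h4 x hx x hx y hy y hy
  have hxyy : x * y * y = 0 := by linear_combination x * hyy + 𝒞 c * hxxxy
  have hyyy : y * y * y = 0 := by linear_combination y * hyy + 𝒞 c * hxxyy
  obtain ⟨f, hf⟩ : ∃ f : F, 3 * f = e := ⟨e / 3, by ring⟩
  obtain ⟨g, hg⟩ : ∃ g : F, 2 * g = c := ⟨c / 2, by ring⟩
  replace hf := congrArg 𝒞 hf
  replace hg := congrArg 𝒞 hg
  simp only [map_mul, map_ofNat] at hf hg
  set x' := x - 𝒞 f * y with hx'
  have hxx' : x' * x' = x * x - 2 * 𝒞 f * (x * y) + 𝒞 f ^ 2 * (y * y) := by rw [hx']; ring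
  have hxxx' : x' * x' * x' = 0 := by
    rw [hx']
    linear_combination hxxx - x * x * y * hf + 3 * 𝒞 f ^ 2 * hxyy - 𝒞 f ^ 3 * hyyy
  set y' := y - 𝒞 g * (x' * x') with hy'
  have hxxy₀ : x' * x' * y = x * x * y := by
    rw [hx']
    linear_combination -2 * 𝒞 f * hxyy + 𝒞 f ^ 2 * hyyy
  have hxxy' : x' * x' * y' = x * x * y := by
    rw [hy', ← hxxy₀]
    linear_combination -𝒞 g * x' * hxxx'
  have hxy' : x' * y' = x * y - 𝒞 f * (y * y) := by
    rw [hy']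
    linear_combination -𝒞 g * hxxx'
  have hyy' : y' * y' = 0 := by
    rw [hy']
    linear_combination hyy - 2 * 𝒞 g * hxxy₀ - x * x * y * hg + 𝒞 g ^ 2 * x' * hxxx'
  have hN' : N ≤ span F ({x', y', x' * x', x' * y', x' * x' * y'} : Set R) := by
    refine hN.trans (span_five_le (mem_span_five.2 ⟨1, f, f * g, 0, 0, ?_⟩)
      (mem_span_five.2 ⟨0, 1, g, 0, 0, ?_⟩)
      (mem_span_five.2 ⟨0, 0, 1, 2 * f, f ^ 2 * c, ?_⟩)
      (mem_span_five.2 ⟨0, 0, 0, 1, f * c, ?_⟩)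
      (mem_span_five.2 ⟨0, 0, 0, 0, 1, ?_⟩)) <;>
      simp only [map_zero, map_one, map_mul, map_pow, map_ofNat]
    · rw [hy', hx']; ring
    · rw [hy']; ring
    · rw [hxxy', hxy', hxx']
      linear_combination 𝒞 f ^ 2 * hyy
    · rw [hxxy', hxy']
      linear_combination 𝒞 f * hyy
    · rw [hxxy']; ring
  refine .of_five_mul hN' rfl (.inr (by simp)) (.inr (by simp)) (.inl ?_)
    (.inr (by simp [mul_assoc])) (.inl ?_) (.inl hyy') (.inr ?_) (.inl ?_) (.inl ?_) (.inl ?_)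
    (.inl ?_) (.inl ?_) (.inl ?_) (.inl ?_) (.inl ?_)
  · linear_combination hxxx'
  · linear_combination y' * hxxx'
  · rw [mul_comm y']; simp
  · linear_combination x' * hyy'
  · linear_combination x' * x' * hyy'
  · linear_combination x' * hxxx'
  · linear_combination y' * hxxx'
  · linear_combination x' * y' * hxxx'
  · linear_combination x' * x' * hyy'
  · linear_combination y' * y' * hxxx'
  · linear_combination x' * y' * y' * hxxx'

omit [CharZero F] in
/-- Products of four elements vanish and `x * x * x` spans the cube. -/
theorem HasMonomialSpan.of_mul_self_eq' (hx : x ∈ N)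
    (h4 : ∀ p ∈ N, ∀ q ∈ N, ∀ r ∈ N, ∀ s ∈ N, p * q * r * s = 0)
    (hN : N ≤ span F ({x, y, x * x, x * y, x * x * x} : Set R)) {c : F}
    (hyy : y * y = 𝒞 c * (x * x * x)) (hxxy : x * x * y = 0) :
    HasMonomialSpan N 5 := by
  have hxxxx := h4 x hx x hx x hx x hx
  have hxyy : x * y * y = 0 := by linear_combination x * hyy + 𝒞 c * hxxxx
  obtain ⟨k, hk, hkc⟩ : ∃ k : F, k ≠ 0 ∧ (k * k * c = 0 ∨ k * k * c = 1) := by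
    rcases eq_or_ne c 0 with rfl | hc
    · exact ⟨1, one_ne_zero, .inl (by simp)⟩
    · obtain ⟨k, hk, h⟩ := exists_mul_self_mul_eq_one hc
      exact ⟨k, hk, .inr h⟩
  have hi := algebraMap_mul_algebraMap_inv (R := R) hk
  have hN' : N ≤ span F ({x, 𝒞 k * y, x * x, x * (𝒞 k * y), x * x * x} : Set R) := by
    refine hN.trans (span_five_le (subset_span (by simp))
      (mem_span_five.2 ⟨0, k⁻¹, 0, 0, 0, ?_⟩) (subset_span (by simp))
      (mem_span_five.2 ⟨0, 0, 0, k⁻¹, 0, ?_⟩) (subset_span (by simp))) <;> simp only [map_zero]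
    · linear_combination -y * hi
    · linear_combination -x * y * hi
  refine .of_five_mul hN' rfl (.inr (by simp)) (.inr (by simp)) (.inr (by simp [mul_assoc]))
    (.inl ?_) (.inl ?_) (hkc.imp (fun h => ?_) (fun h => ?_)) (.inl ?_) (.inl ?_) (.inl ?_)
    (.inl ?_) (.inl ?_) (.inl ?_) (.inl ?_) (.inl ?_) (.inl ?_)
  · linear_combination 𝒞 k * hxxy
  · linear_combination hxxxx
  · replace h := congrArg 𝒞 h
    simp only [map_mul, map_zero] at h
    linear_combination 𝒞 k * 𝒞 k * hyy + x * x * x * h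
  · replace h := congrArg 𝒞 h
    simp only [map_mul, map_one] at h
    have : 𝒞 k * y * (𝒞 k * y) = x * x * x := by
      linear_combination 𝒞 k * 𝒞 k * hyy + x * x * x * h
    simp [this]
  · linear_combination 𝒞 k * hxxy
  · linear_combination 𝒞 k * 𝒞 k * hxyy
  · linear_combination 𝒞 k * x * hxxy
  · linear_combination hxxxx
  · linear_combination 𝒞 k * x * hxxy
  · linear_combination x * hxxxx
  · linear_combination 𝒞 k * 𝒞 k * x * hxyy
  · linear_combination 𝒞 k * x * x * hxxy
  · linear_combination x * x * hxxxx

end Cubic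

end TwoGenerators

section TwoGenerated

variable {F R : Type*} [Field F] [CommRing R] [Algebra F R]

local notation "𝒞" => algebraMap F R

theorem Submodule.exists_le_span_pair_sup [FiniteDimensional F R] {A B : Submodule F R}
    (hBA : B ≤ A) (h : Module.finrank F A ≤ Module.finrank F B + 2) :
    ∃ x ∈ A, ∃ y ∈ A, A ≤ span F {x, y} ⊔ B := by
  obtain ⟨v, hv, hA⟩ := exists_le_span_sup 2 hBA h
  refine ⟨v 0, hv 0, v 1, hv 1, hA.trans (sup_le_sup_right (span_mono ?_) B)⟩
  rintro _ ⟨i, rfl⟩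
  fin_cases i <;> simp

theorem Submodule.mem_of_algebraMap_mul_mem {P : Submodule F R} {k : F} (hk : k ≠ 0) {v : R}
    (h : 𝒞 k * v ∈ P) : v ∈ P := by
  rwa [← Algebra.smul_def, P.smul_mem_iff hk] at h

/-- A pair of generators can be changed so that one of the products `x * y` and `y * y` lies in a
subspace `B` of codimension at most two. -/
theorem exists_span_pair_eq_of_finrank_le [FiniteDimensional F R] [IsAlgClosed F] [CharZero F]
    {A B : Submodule F R} (hBA : B ≤ A) (h : Module.finrank F A ≤ Module.finrank F B + 2)
    {x y : R} (hxx : x * x ∈ A) (hxy : x * y ∈ A) (hyy : y * y ∈ A) :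
    ∃ v w : R, span F ({v, w} : Set R) = span F {x, y} ∧ (v * w ∈ B ∨ w * w ∈ B) := by
  obtain ⟨g, hg, hgB⟩ := exists_sum_smul_mem hBA h (m := 3) (by norm_num)
    (v := ![x * x, x * y, y * y]) (by intro i; fin_cases i <;> simpa)
  have hg' : ¬ (g 0 = 0 ∧ g 1 = 0 ∧ g 2 = 0) := fun ⟨h0, h1, h2⟩ =>
    hg (funext fun i => by fin_cases i <;> assumption)
  obtain ⟨v, w, hvw, k, hk, h | h⟩ := exists_span_pair_eq_of_quadratic (R := R) hg' x y <;>
    simp only [Fin.sum_univ_three, Algebra.smul_def, Matrix.cons_val] at hgB <;>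
    rw [h] at hgB
  · exact ⟨v, w, hvw, .inl (mem_of_algebraMap_mul_mem hk hgB)⟩
  · exact ⟨w, v, by rw [Set.pair_comm, hvw], .inr (mem_of_algebraMap_mul_mem hk hgB)⟩

theorem HasMonomialSpan.of_le_span_pair_sup {N : Submodule F R} (h3 : N * N * N = ⊥) {x y : R}
    (hx : x ∈ N) (hy : y ∈ N) (hN : N ≤ span F {x, y} ⊔ N * N) : HasMonomialSpan N 5 := by
  have hmul : ∀ p ∈ N, ∀ q ∈ N, ∀ r ∈ N, p * q * r = 0 := fun p hp q hq r hr =>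
    (mem_bot F).1 (h3 ▸ mul_mem_mul (mul_mem_mul hp hq) hr)
  have hN2 : N * N ≤ span F {x, y} * span F {x, y} := by
    have := mul_le_span_sup (A := N) (by rintro _ (rfl | rfl) <;> assumption) hN hN
    rwa [← mul_assoc, h3, sup_bot_eq, sup_bot_eq, ← span_mul_span] at this
  have hN' : N ≤ span F ({x, y, x * x, x * y, y * y} : Set R) := by
    refine hN.trans (sup_le (span_mono ?_) (hN2.trans ?_))
    · rintro _ (rfl | rfl) <;> simp
    · exact span_pair_mul_span_pair_le (subset_span (by simp)) (subset_span (by simp))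
        (subset_span (by simp))
  refine .of_five_mul hN' rfl (.inr (by simp)) (.inr (by simp)) ?_ ?_ ?_ (.inr (by simp))
    ?_ ?_ ?_ ?_ ?_ ?_ ?_ ?_ ?_
  all_goals left
  · linear_combination hmul x hx x hx x hx
  · linear_combination hmul x hx x hx y hy
  · linear_combination hmul x hx y hy y hy
  · linear_combination hmul x hx x hx y hy
  · linear_combination hmul x hx y hy y hy
  · linear_combination hmul y hy y hy y hy
  · linear_combination x * hmul x hx x hx x hx
  · linear_combination x * hmul x hx x hx y hy
  · linear_combination x * hmul x hx y hy y hy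
  · linear_combination x * hmul x hx y hy y hy
  · linear_combination x * hmul y hy y hy y hy
  · linear_combination y * hmul y hy y hy y hy

theorem HasMonomialSpan.of_finrank_cube_eq_one [FiniteDimensional F R] [IsAlgClosed F]
    [CharZero F] {N : Submodule F R} (hNN : N * N ≤ N) (h4 : N * N * N * N = ⊥)
    (hd₁ : Module.finrank F N ≤ Module.finrank F ↥(N * N) + 2)
    (hd₂ : Module.finrank F ↥(N * N) ≤ Module.finrank F ↥(N * N * N) + 2)
    (hd₃ : Module.finrank F ↥(N * N * N) = 1) : HasMonomialSpan N 5 := by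
  have hmul : ∀ p ∈ N, ∀ q ∈ N, ∀ r ∈ N, ∀ s ∈ N, p * q * r * s = 0 :=
    fun p hp q hq r hr s hs =>
      (mem_bot F).1 (h4 ▸ mul_mem_mul (mul_mem_mul (mul_mem_mul hp hq) hr) hs)
  have hmul' : ∀ p ∈ N * N * N, ∀ q ∈ N, p * q = 0 :=
    fun p hp q hq => (mem_bot F).1 (h4 ▸ mul_mem_mul hp hq)
  obtain ⟨x₀, hx₀, y₀, hy₀, hN₀⟩ := exists_le_span_pair_sup hNN hd₁
  obtain ⟨x, y, hxy₀, h⟩ := exists_span_pair_eq_of_finrank_le (mul_le_mul_left hNN N) hd₂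
    (mul_mem_mul hx₀ hx₀) (mul_mem_mul hx₀ hy₀) (mul_mem_mul hy₀ hy₀)
  have hN : N ≤ span F {x, y} ⊔ N * N := by rwa [hxy₀]
  have hxyN : span F {x, y} ≤ N := by
    rw [hxy₀, span_le]
    rintro _ (rfl | rfl) <;> assumption
  have hx : x ∈ N := hxyN (subset_span (by simp))
  have hy : y ∈ N := hxyN (subset_span (by simp))
  clear! x₀ y₀
  have hsub : ({x, y} : Set R) ⊆ N := by rintro _ (rfl | rfl) <;> assumption
  have hN2 : N * N ≤ span F {x, y} * span F {x, y} ⊔ N * N * N := by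
    have := mul_le_span_sup hsub hN hN
    rwa [← mul_assoc, sup_idem, ← span_mul_span] at this
  have hN3 : N * N * N ≤ span F {x, y} * span F {x, y} * span F {x, y} := by
    rw [span_mul_span] at hN2
    have := mul_le_span_sup (A := N * N) (Set.mul_subset_iff.2 fun a ha b hb =>
      mul_mem_mul (hsub ha) (hsub hb)) hN2 hN
    rwa [← mul_assoc, h4, sup_bot_eq, sup_bot_eq, ← span_mul_span, ← span_mul_span] at this
  have hspan : ∀ {t}, t ∈ N * N * N → t ≠ 0 → N * N * N ≤ span F {t} := by
    intro t ht ht0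
    exact (eq_of_le_of_finrank_le (by simpa using ht)
      (by rw [hd₃, finrank_span_singleton ht0])).ge
  have hcoe : ∀ {t}, t ∈ N * N * N → t ≠ 0 → ∀ v ∈ N * N * N, ∃ c : F, v = 𝒞 c * t := by
    intro t ht ht0 v hv
    obtain ⟨c, hc⟩ := mem_span_singleton.1 (hspan ht ht0 hv)
    exact ⟨c, by rw [← hc, Algebra.smul_def]⟩
  have hne : ¬ (x * x * x = 0 ∧ x * x * y = 0 ∧ x * y * y = 0 ∧ y * y * y = 0) := by
    rintro ⟨h1, h2, h3, h4⟩
    have h0 : N * N * N = ⊥ := le_bot_iff.1 <| hN3.trans <|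
      span_pair_pow_three_le (by simpa) (by simpa) (by simpa) (by simpa)
    rw [h0, finrank_bot] at hd₃
    exact zero_ne_one hd₃
  have hc : ∀ {p q r}, p ∈ N → q ∈ N → r ∈ N → p * q * r ∈ N * N * N :=
    fun hp hq hr => mul_mem_mul (mul_mem_mul hp hq) hr
  have hle : ∀ {p : Submodule F R}, x ∈ p → y ∈ p → x * x ∈ p → x * y ∈ p → y * y ∈ p →
      N * N * N ≤ p → N ≤ p := by
    intro p h1 h2 h3 h4 h5 h6
    refine hN.trans (sup_le (span_le.2 ?_)
      (hN2.trans (sup_le (span_pair_mul_span_pair_le h3 h4 h5) h6)))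
    rintro _ (rfl | rfl) <;> assumption
  rcases h with hxy | hyy
  · clear hN hxyN hsub hN2 hN3
    have hxxy : x * x * y = 0 := by linear_combination hmul' _ hxy x hx
    have hxyy : x * y * y = 0 := hmul' _ hxy y hy
    wlog hxxx : x * x * x ≠ 0 generalizing x y
    · rw [mul_comm x y] at hxy hle
      refine this y x hy hx (fun h => hne ⟨h.2.2.2, hxxy, hxyy, h.1⟩)
        (fun h1 h2 h3 h4 h5 h6 => hle h2 h1 h5 h4 h3 h6) hxy
        (by linear_combination hxyy) (by linear_combination hxxy) fun h => hne ?_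
      exact ⟨not_ne_iff.1 hxxx, hxxy, hxyy, h⟩
    obtain ⟨c, hxy'⟩ := hcoe (hc hx hx hx) hxxx _ hxy
    obtain ⟨e, hyyy⟩ := hcoe (hc hx hx hx) hxxx _ (hc hy hy hy)
    have h3 := (hspan (hc hx hx hx) hxxx).trans (span_mono (s := {x * x * x})
      (t := {x, y, x * x, y * y, x * x * x}) (by simp))
    exact .of_mul_eq hx hy hmul (hle (subset_span (by simp)) (subset_span (by simp))
      (subset_span (by simp)) (h3 hxy) (subset_span (by simp)) h3) hxy' hyyy
      (hNN (mul_mem_mul hx hx))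
  · have hxyy : x * y * y = 0 := by linear_combination hmul' _ hyy x hx
    have hyyy : y * y * y = 0 := hmul' _ hyy y hy
    by_cases hxxy : x * x * y = 0
    · have hxxx : x * x * x ≠ 0 := fun h => hne ⟨h, hxxy, hxyy, hyyy⟩
      obtain ⟨c, hyy'⟩ := hcoe (hc hx hx hx) hxxx _ hyy
      have h3 := (hspan (hc hx hx hx) hxxx).trans (span_mono (s := {x * x * x})
        (t := {x, y, x * x, x * y, x * x * x}) (by simp))
      exact .of_mul_self_eq' hx hmul (hle (subset_span (by simp)) (subset_span (by simp))
        (subset_span (by simp)) (subset_span (by simp)) (h3 hyy) h3) hyy' hxxy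
    · obtain ⟨c, hyy'⟩ := hcoe (hc hx hx hy) hxxy _ hyy
      obtain ⟨e, hxxx⟩ := hcoe (hc hx hx hy) hxxy _ (hc hx hx hx)
      have h3 := (hspan (hc hx hx hy) hxxy).trans (span_mono (s := {x * x * y})
        (t := {x, y, x * x, x * y, x * x * y}) (by simp))
      exact .of_mul_self_eq hx hy hmul (hle (subset_span (by simp)) (subset_span (by simp))
        (subset_span (by simp)) (subset_span (by simp)) (h3 hyy) h3) hyy' hxxx

end TwoGenerated

section ThreeGenerated

variable {F R : Type*} [Field F] [CommRing R] [Algebra F R]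

local notation "𝒞" => algebraMap F R

/-- A pencil of square matrices has a singular member. -/
theorem Matrix.exists_mulVec_eq_zero_or_eq_smul [IsAlgClosed F] {n : Type*} [Fintype n]
    [DecidableEq n] [Nonempty n] (A B : Matrix n n F) :
    ∃ c : n → F, c ≠ 0 ∧ (B.mulVec c = 0 ∨ ∃ t : F, A.mulVec c = t • B.mulVec c) := by
  by_cases hB : B.det = 0
  · obtain ⟨c, hc, h⟩ := Matrix.exists_mulVec_eq_zero_iff.2 hB
    exact ⟨c, hc, .inl h⟩
  · obtain ⟨t, ht⟩ := Module.End.exists_eigenvalue (Matrix.toLin' (B⁻¹ * A))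
    obtain ⟨c, hc⟩ := ht.exists_hasEigenvector
    refine ⟨c, hc.2, .inr ⟨t, ?_⟩⟩
    have h := congrArg B.mulVec hc.apply_eq_smul
    rwa [Matrix.toLin'_apply, Matrix.mulVec_mulVec, ← mul_assoc,
      Matrix.mul_nonsing_inv _ (Ne.isUnit hB), one_mul, Matrix.mulVec_smul] at h

/-- If the products of three elements lie in a plane, some combination of them multiplies all of
them into a line of the plane. -/
theorem exists_sum_mul_mem_span_singleton [IsAlgClosed F] {a b : R} {v : Fin 3 → R}
    (hv : ∀ i j, v i * v j ∈ span F {a, b}) :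
    ∃ c : Fin 3 → F, c ≠ 0 ∧ ∃ a' b' : R, span F ({a', b'} : Set R) = span F {a, b} ∧
      ∀ j, (∑ i, c i • v i) * v j ∈ span F {a'} := by
  choose A B hAB using fun i j => mem_span_two.1 (hv i j)
  obtain ⟨c, hc, h⟩ := Matrix.exists_mulVec_eq_zero_or_eq_smul (Matrix.of A) (Matrix.of B)
  have key : ∀ j, (∑ i, c i • v i) * v j =
      𝒞 ((Matrix.of A).mulVec c j) * a + 𝒞 ((Matrix.of B).mulVec c j) * b := by
    intro j
    simp only [Matrix.mulVec, dotProduct, Matrix.of_apply, map_sum, map_mul, Finset.sum_mul,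
      ← Finset.sum_add_distrib, Algebra.smul_def]
    refine Finset.sum_congr rfl fun i _ => ?_
    linear_combination 𝒞 (c i) * hAB j i
  refine ⟨c, hc, ?_⟩
  rcases h with h | ⟨t, h⟩
  · refine ⟨a, b, rfl, fun j => mem_span_singleton.2 ⟨(Matrix.of A).mulVec c j, ?_⟩⟩
    rw [key, h, Algebra.smul_def, Pi.zero_apply, map_zero, zero_mul, add_zero]
  · refine ⟨𝒞 t * a + b, a, span_pair_eq (mem_span_two.2 ⟨t, 1, by simp⟩)
      (subset_span (by simp)) (subset_span (by simp)) (mem_span_two.2 ⟨1, -t, by simp⟩),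
      fun j => mem_span_singleton.2 ⟨(Matrix.of B).mulVec c j, ?_⟩⟩
    rw [key, h, Algebra.smul_def, Pi.smul_apply, smul_eq_mul, map_mul]
    ring

theorem exists_range_subset_span_of_ne_zero (v : Fin 3 → R) {c : Fin 3 → F} (hc : c ≠ 0) :
    ∃ j k, Set.range v ⊆ span F ({∑ i, c i • v i, v j, v k} : Set R) := by
  obtain ⟨i, hi⟩ := Function.ne_iff.1 hc
  refine ⟨i + 1, i + 2, ?_⟩
  have huniv : ∀ i j : Fin 3, j = i ∨ j = i + 1 ∨ j = i + 2 := by decide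
  have hsum : ∀ f : Fin 3 → R, ∑ j, f j = f i + f (i + 1) + f (i + 2) := by
    intro f
    fin_cases i <;> simp [Fin.sum_univ_three] <;> ring
  set p := span F ({∑ i, c i • v i, v (i + 1), v (i + 2)} : Set R) with hp
  have h1 : v (i + 1) ∈ p := subset_span (by simp)
  have h2 : v (i + 2) ∈ p := subset_span (by simp)
  have h0 : v i ∈ p := by
    rw [← p.smul_mem_iff hi]
    have : c i • v i = (∑ i, c i • v i) - c (i + 1) • v (i + 1) - c (i + 2) • v (i + 2) := by
      rw [hsum]; ring
    rw [this]
    exact sub_mem (sub_mem (subset_span (by simp)) (p.smul_mem _ h1)) (p.smul_mem _ h2)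
  rintro _ ⟨j, rfl⟩
  rcases huniv i j with rfl | rfl | rfl <;> assumption

theorem HasMonomialSpan.of_finrank_mul_self_eq_two [FiniteDimensional F R] [IsAlgClosed F]
    [CharZero F] {N : Submodule F R} (hNN : N * N ≤ N) (h3 : N * N * N = ⊥)
    (hd₁ : Module.finrank F N ≤ Module.finrank F ↥(N * N) + 3)
    (hd₂ : Module.finrank F ↥(N * N) = 2) : HasMonomialSpan N 5 := by
  have hmul : ∀ p ∈ N, ∀ q ∈ N * N, p * q = 0 := fun p hp q hq => by
    rw [mul_comm]
    exact (mem_bot F).1 (h3 ▸ mul_mem_mul hq hp)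
  obtain ⟨v, hv, hN⟩ := exists_le_span_sup 3 hNN hd₁
  obtain ⟨a₀, ha₀, b₀, hb₀, hab₀⟩ := exists_le_span_pair_sup (A := N * N) (B := ⊥) bot_le
    (by simp [hd₂])
  have hab₀ : N * N = span F {a₀, b₀} := by
    refine le_antisymm (by simpa using hab₀) (span_le.2 ?_)
    rintro _ (rfl | rfl) <;> assumption
  obtain ⟨c, hc, a, b, hab, hu⟩ := exists_sum_mul_mem_span_singleton (F := F) (v := v)
    fun i j => hab₀ ▸ mul_mem_mul (hv i) (hv j)
  obtain ⟨j, k, hjk⟩ := exists_range_subset_span_of_ne_zero v hc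
  rw [← hab] at hab₀
  set x := ∑ i, c i • v i with hx
  have hxN : x ∈ N := sum_mem fun i _ => N.smul_mem _ (hv i)
  have ha : a ∈ N * N := hab₀ ▸ subset_span (by simp)
  have hb : b ∈ N * N := hab₀ ▸ subset_span (by simp)
  have hxv : ∀ w ∈ span F (Set.range v), x * w ∈ span F {a} := by
    intro w hw
    induction hw using span_induction with
    | mem w hw => obtain ⟨i, rfl⟩ := hw; exact hu i
    | zero => simp
    | add w₁ w₂ _ _ h₁ h₂ => rw [mul_add]; exact add_mem h₁ h₂
    | smul r w _ h => rw [mul_smul_comm]; exact smul_mem _ r h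
  have hxx : x * x ∈ span F {a} :=
    hxv x (sum_mem fun i _ => smul_mem _ _ (subset_span ⟨i, rfl⟩))
  have hframe : ∀ {y z a' b'}, y ∈ N → z ∈ N → a' ∈ N * N → b' ∈ N * N →
      v j ∈ span F ({y, z} : Set R) → v k ∈ span F ({y, z} : Set R) →
      N * N ≤ span F {a', b'} → SocleFrame N x y z a' b' := by
    intro y z a' b' hy hz ha' hb' hjy hky hN2
    refine ⟨hN.trans (sup_le ?_ (hN2.trans (span_mono ?_))), hxN, hy, hz, hNN ha', hNN hb',
      fun w hw => hmul w hw a' ha', fun w hw => hmul w hw b' hb'⟩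
    · have hle : span F {y, z} ≤ span F ({x, y, z, a', b'} : Set R) := span_mono (by
        rintro _ (rfl | rfl) <;> simp)
      refine span_le.2 (hjk.trans (span_le.2 ?_))
      rintro _ (rfl | rfl | rfl)
      exacts [subset_span (by simp), hle hjy, hle hky]
    · rintro _ (rfl | rfl) <;> simp
  have hyy := mul_mem_mul (hv j) (hv j)
  have hyz := mul_mem_mul (hv j) (hv k)
  have hzz := mul_mem_mul (hv k) (hv k)
  have h0 := hframe (hv j) (hv k) ha hb (subset_span (by simp)) (subset_span (by simp)) hab₀.le
  have hN2 : ∀ {p : Submodule F R}, x * x ∈ p → x * v j ∈ p → x * v k ∈ p → v j * v j ∈ p →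
      v j * v k ∈ p → v k * v k ∈ p → N * N ≤ p := by
    intro p h1 h2 h3' h4 h5 h6
    have hx3 : ({x, v j, v k} : Set R) ⊆ N := by
      rintro _ (rfl | rfl | rfl)
      exacts [hxN, hv j, hv k]
    have hN' : N ≤ span F {x, v j, v k} ⊔ N * N :=
      hN.trans (sup_le_sup_right (span_le.2 hjk) _)
    have := mul_le_span_sup hx3 hN' hN'
    rw [← mul_assoc, h3, sup_bot_eq, sup_bot_eq] at this
    refine this.trans (span_le.2 ?_)
    rintro _ ⟨u, (rfl | rfl | rfl), w, (rfl | rfl | rfl), rfl⟩ <;>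
      first | assumption | (change _ * _ ∈ p; rw [mul_comm]; assumption)
  obtain ⟨c₁, hc₁⟩ := mem_span_singleton.1 hxx
  obtain ⟨c₂, hc₂⟩ := mem_span_singleton.1 (hu j)
  obtain ⟨c₃, hc₃⟩ := mem_span_singleton.1 (hu k)
  rw [Algebra.smul_def] at hc₁ hc₂ hc₃
  by_cases hcc : c₁ = 0 ∧ c₂ = 0 ∧ c₃ = 0
  · obtain ⟨rfl, rfl, rfl⟩ := hcc
    simp only [map_zero, zero_mul] at hc₁ hc₂ hc₃
    obtain ⟨y, z, hyz', h⟩ := exists_span_pair_eq_of_finrank_le (A := N * N) (B := ⊥) bot_le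
      (by simp [hd₂]) hyy hyz hzz
    have hle : span F {y, z} ≤ N := by
      rw [hyz', span_le]
      rintro _ (rfl | rfl)
      exacts [hv j, hv k]
    have hj : v j ∈ span F ({y, z} : Set R) := hyz' ▸ subset_span (by simp)
    have hk : v k ∈ span F ({y, z} : Set R) := hyz' ▸ subset_span (by simp)
    have hy : y ∈ N := hle (subset_span (by simp))
    have hz : z ∈ N := hle (subset_span (by simp))
    have hx0 : ∀ w ∈ span F ({y, z} : Set R), x * w = 0 := by
      intro w hw
      obtain ⟨r, s, rfl⟩ := mem_span_two.1 (hyz' ▸ hw)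
      linear_combination -𝒞 r * hc₂ - 𝒞 s * hc₃
    have hN2' : ∀ {p : Submodule F R}, y * y ∈ p → y * z ∈ p → z * z ∈ p → N * N ≤ p := by
      intro p h1 h2 h3
      have := span_pair_mul_span_pair_le h1 h2 h3
      exact hN2 (by simp [← hc₁]) (by simp [← hc₂]) (by simp [← hc₃])
        (this (mul_mem_mul hj hj)) (this (mul_mem_mul hj hk)) (this (mul_mem_mul hk hk))
    have hxy := hx0 y (subset_span (by simp))
    have hxz := hx0 z (subset_span (by simp))
    simp only [mem_bot] at h
    rcases h with h | h
    · refine (hframe hy hz (mul_mem_mul hy hy) (mul_mem_mul hz hz) hj hk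
        (hN2' (subset_span (by simp)) (by simp [h]) (subset_span (by simp)))).hasMonomialSpan
        (.inl hc₁.symm) (.inl hxy) (.inl hxz) (.inr (.inl rfl)) (.inl h) (.inr (.inr rfl))
    · refine (hframe hy hz (mul_mem_mul hy hy) (mul_mem_mul hy hz) hj hk
        (hN2' (subset_span (by simp)) (subset_span (by simp)) (by simp [h]))).hasMonomialSpan
        (.inl hc₁.symm) (.inl hxy) (.inl hxz) (.inr (.inl rfl)) (.inr (.inr rfl)) (.inl h)
  · obtain ⟨p₁, q₁, h₁⟩ := mem_span_two.1 (hab₀ ▸ hyy)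
    obtain ⟨p₂, q₂, h₂⟩ := mem_span_two.1 (hab₀ ▸ hyz)
    obtain ⟨p₃, q₃, h₃⟩ := mem_span_two.1 (hab₀ ▸ hzz)
    refine h0.hasMonomialSpan_of_rank_one hc₁.symm hc₂.symm hc₃.symm h₁ h₂ h₃ ?_ hcc
    rintro ⟨rfl, rfl, rfl⟩
    simp only [map_zero, zero_mul, add_zero] at h₁ h₂ h₃
    have hmem : ∀ r, 𝒞 r * a ∈ span F {a} := fun r =>
      algebraMap_mul_mem r (mem_span_singleton_self a)
    have hle : N * N ≤ span F {a} := hN2 hxx (hu j) (hu k) (h₁ ▸ hmem _) (h₂ ▸ hmem _)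
      (h₃ ▸ hmem _)
    have h4 := Submodule.finrank_mono hle
    have h5 : Module.finrank F (span F {a}) ≤ 1 :=
      (finrank_span_le_card (R := F) ({a} : Set R)).trans (by simp)
    omega

end ThreeGenerated

section FiveDimensional

open scoped Pointwise

variable {F R : Type*} [Field F] [CommRing R] [Algebra F R] [FiniteDimensional F R]

theorem HasMonomialSpan.of_finrank_eq_five [IsAlgClosed F] [CharZero F] {N : Submodule F R}
    {k : ℕ} (hNN : N * N ≤ N) (hk : N ^ k = ⊥) (hd : Module.finrank F N = 5) :
    HasMonomialSpan N 5 := by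
  by_cases hd₂ : Module.finrank F ↥(N * N) ≤ Module.finrank F ↥(N * N * N) + 1
  · rw [← hd]
    exact .of_finrank_mul_self_le hNN hk hd₂
  have h32 : N * N * N ≤ N * N := mul_le_mul_left hNN N
  have h43 : N * N * N * N ≤ N * N * N := mul_le_mul_left h32 N
  have hd₁ : Module.finrank F ↥(N * N) + 2 ≤ Module.finrank F N := by
    by_contra! h
    obtain ⟨x, hx, hN⟩ := exists_le_span_sup 1 hNN (by omega)
    have h2 := mul_le_span_sup (Set.range_subset_iff.2 hx) hN hN
    rw [← mul_assoc, sup_idem] at h2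
    have h4 : Set.range x * Set.range x = {x 0 * x 0} := by simp [Set.range_unique]
    rw [h4] at h2
    have h5 := (Submodule.finrank_mono h2).trans (finrank_add_le_finrank_add_finrank _ _)
    have h6 : Module.finrank F (span F {x 0 * x 0}) ≤ 1 :=
      (finrank_span_le_card (R := F) ({x 0 * x 0} : Set R)).trans (by simp)
    omega
  have h4 : N * N * N * N = ⊥ := by
    by_contra h
    have hlt : N * N * N * N < N * N * N :=
      lt_of_le_of_ne h43 fun he => h (by rw [he]; exact eq_bot_of_le_mul hk he.ge)
    have h5 := Submodule.finrank_lt_finrank_of_lt hlt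
    have h6 : Module.finrank F ↥(N * N * N * N) ≠ 0 := by rwa [Ne, finrank_eq_zero]
    omega
  by_cases h3 : N * N * N = ⊥
  · have h5 : Module.finrank F ↥(N * N * N) = 0 := by rw [h3, finrank_bot]
    by_cases hd₃ : Module.finrank F ↥(N * N) = 2
    · exact .of_finrank_mul_self_eq_two hNN h3 (by omega) hd₃
    · obtain ⟨x, hx, y, hy, hN⟩ := exists_le_span_pair_sup hNN (by omega)
      exact .of_le_span_pair_sup h3 hx hy hN
  · have h5 : Module.finrank F ↥(N * N * N) ≠ 0 := by rwa [Ne, finrank_eq_zero]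
    exact .of_finrank_cube_eq_one hNN h4 (by omega) (by omega) (by omega)

end FiveDimensional

section MultiplicationTable

variable {F : Type*} [Field F] {n : ℕ}

/-- Some basis of `R` is closed under multiplication up to zeros, as prescribed by `T`. -/
def HasMultiplicationTable (F R : Type*) [Field F] [CommRing R] [Algebra F R] {n : ℕ}
    (T : Fin n → Fin n → Option (Fin n)) : Prop :=
  ∃ b : Module.Basis (Fin n) F R, ∀ i j, b i * b j = (T i j).elim 0 b

theorem HasMultiplicationTable.nonempty_algEquiv {R S : Type*} [CommRing R] [Algebra F R]
    [CommRing S] [Algebra F S] {T : Fin n → Fin n → Option (Fin n)}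
    (hR : HasMultiplicationTable F R T) (hS : HasMultiplicationTable F S T) :
    Nonempty (R ≃ₐ[F] S) := by
  obtain ⟨b, hb⟩ := hR
  obtain ⟨c, hc⟩ := hS
  let e : R ≃ₗ[F] S := b.equiv c (Equiv.refl _)
  have he : ∀ i, e (b i) = c i := fun i => by simp [e]
  have hmul : ∀ u v, e (u * v) = e u * e v := by
    have : (LinearMap.mul F R).compr₂ e.toLinearMap =
        (LinearMap.mul F S).compl₁₂ e.toLinearMap e.toLinearMap := by
      refine b.ext fun i => b.ext fun j => ?_
      simp only [LinearMap.compr₂_apply, LinearMap.compl₁₂_apply, LinearMap.mul_apply',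
        LinearEquiv.coe_coe, hb, hc, he]
      cases T i j <;> simp [he]
    exact fun u v => LinearMap.congr_fun₂ this u v
  have hone : e 1 = 1 := by
    obtain ⟨u, hu⟩ := e.surjective 1
    rw [← mul_one (e 1), ← hu, ← hmul, one_mul]
  exact ⟨AlgEquiv.ofLinearEquiv e hone hmul⟩

theorem HasMonomialSpan.exists_hasMultiplicationTable {R : Type*} [CommRing R] [Algebra F R]
    {N : Submodule F R} (hN : HasMonomialSpan N n) (htop : ⊤ ≤ span F {1} ⊔ N)
    (hd : Module.finrank F R = n + 1) :
    ∃ T : Fin (n + 1) → Fin (n + 1) → Option (Fin (n + 1)), HasMultiplicationTable F R T := by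
  classical
  obtain ⟨s, hs, hNs, hmul⟩ := hN
  set t : Finset R := insert 1 s with ht
  have htmul : ∀ u ∈ t, ∀ v ∈ t, u * v = 0 ∨ u * v ∈ t := by
    intro u hu v hv
    rcases Finset.mem_insert.1 hu with rfl | hu'
    · exact .inr (by rwa [one_mul])
    rcases Finset.mem_insert.1 hv with rfl | hv'
    · exact .inr (by rwa [mul_one])
    exact (hmul u hu' v hv').imp_right Finset.mem_insert_of_mem
  have hspan : ⊤ ≤ span F (t : Set R) := by
    refine htop.trans ?_
    rw [ht, Finset.coe_insert, span_insert]
    exact sup_le_sup_left hNs _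
  have hcard : t.card = n + 1 := by
    refine le_antisymm ((Finset.card_insert_le _ _).trans (by omega)) ?_
    rw [← hd, ← finrank_top, ← top_le_iff.1 hspan]
    exact finrank_span_finset_le_card t
  let e := t.equivFinOfCardEq hcard
  let b : Module.Basis (Fin (n + 1)) F R :=
    basisOfTopLeSpanOfCardEqFinrank (fun i => (e.symm i : R))
      (by rw [Set.range_comp' Subtype.val e.symm, e.symm.range_eq_univ, Set.image_univ,
            Subtype.range_coe]
          exact hspan)
      (by rw [hd, Fintype.card_fin])
  have hb : ∀ i, b i = e.symm i := fun i => by simp [b]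
  have hT : ∀ i j, ∃ o : Option (Fin (n + 1)), b i * b j = o.elim 0 b := by
    intro i j
    rcases htmul _ (e.symm i).2 _ (e.symm j).2 with h | h
    · exact ⟨none, by rw [hb, hb, h]; rfl⟩
    · exact ⟨some (e ⟨_, h⟩), by simp [hb]⟩
  choose T hT using hT
  exact ⟨T, b, hT⟩

variable [IsAlgClosed F] [CharZero F]

theorem IsLocalRing.exists_hasMultiplicationTable {R : Type*} [CommRing R] [IsLocalRing R]
    [Algebra F R] (hd : Module.finrank F R = 6) :
    ∃ T : Fin 6 → Fin 6 → Option (Fin 6), HasMultiplicationTable F R T := by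
  have : FiniteDimensional F R := Module.finite_of_finrank_pos (by omega)
  have : IsArtinianRing R := isArtinian_of_tower F inferInstance
  set m := IsLocalRing.maximalIdeal R with hm
  obtain ⟨k, hk⟩ : IsNilpotent m := by
    rw [hm, ← IsLocalRing.jacobson_eq_maximalIdeal ⊥ bot_ne_top]
    exact IsArtinianRing.isNilpotent_jacobson_bot
  set N := m.restrictScalars F with hN
  have hNN : N * N ≤ N := mul_le.2 fun u _ v hv => m.mul_mem_left u hv
  have hpow : ∀ i, ∀ u ∈ N ^ i, u ∈ m ^ i := by
    intro i
    induction i with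
    | zero => simp
    | succ i ih =>
      intro u hu
      rw [pow_succ] at hu ⊢
      induction hu using Submodule.mul_induction_on' with
      | mem_mul_mem v hv w hw => exact Ideal.mul_mem_mul (ih v hv) hw
      | add v _ w _ hv hw => exact add_mem hv hw
  have hNk : N ^ k = ⊥ := eq_bot_iff.2 fun u hu => by
    simpa [hk] using hpow k u hu
  have htop : span F {1} ⊔ N = ⊤ := by
    refine eq_top_iff.2 fun u _ => ?_
    obtain ⟨c, hc⟩ := spectrum.nonempty_of_isAlgClosed_of_finiteDimensional F u
    have h1 : algebraMap F R c - u ∈ N := by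
      rw [spectrum.mem_iff] at hc
      exact (IsLocalRing.mem_maximalIdeal _).2 hc
    have h2 : u = c • 1 + -(algebraMap F R c - u) := by
      rw [Algebra.smul_def]; ring
    rw [h2]
    exact add_mem (mem_sup_left (smul_mem _ c (mem_span_singleton_self 1)))
      (mem_sup_right (neg_mem h1))
  have hinf : span F {1} ⊓ N = ⊥ := by
    refine eq_bot_iff.2 fun u ⟨hu, huN⟩ => ?_
    obtain ⟨c, rfl⟩ := mem_span_singleton.1 hu
    by_contra h
    have hc : c ≠ 0 := by
      rintro rfl
      simp at h
    have h1 : (1 : R) ∈ m := (N.smul_mem_iff hc).1 huN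
    exact (IsLocalRing.maximalIdeal.isMaximal R).ne_top ((Ideal.eq_top_iff_one m).2 h1)
  have hd5 : Module.finrank F N = 5 := by
    have h := finrank_sup_add_finrank_inf_eq (span F {(1 : R)}) N
    rw [htop, hinf, finrank_top, finrank_bot, finrank_span_singleton one_ne_zero] at h
    omega
  exact (HasMonomialSpan.of_finrank_eq_five hNN hNk hd5).exists_hasMultiplicationTable
    htop.ge hd

end MultiplicationTable

end

/-- over an algebraically closed field F of characteristic zero, there are only
finitely many isomorphism classes of commutative local F-algebras of F-dimension 6: a finite
list R_1, …, R_k such that every such algebra is isomorphic to some R_i. -/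
theorem stmt_11 (F : Type u) [Field F] [IsAlgClosed F] [CharZero F] :
    ∃ (k : ℕ) (A : Fin k → LocalAlgebraOfDim F 6),
      ∀ R : LocalAlgebraOfDim F 6, ∃ i : Fin k,
        Nonempty (R.carrier ≃ₐ[F] (A i).carrier) := by
  classical
  let ι := {T : Fin 6 → Fin 6 → Option (Fin 6) //
    ∃ R : LocalAlgebraOfDim F 6, HasMultiplicationTable F R.carrier T}
  have hι : ∀ T : ι, ∃ R : LocalAlgebraOfDim F 6, HasMultiplicationTable F R.carrier T.1 :=
    fun T => T.2
  choose A hA using hι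
  let e := Fintype.equivFin ι
  refine ⟨Fintype.card ι, A ∘ e.symm, fun R => ?_⟩
  obtain ⟨T, hT⟩ := IsLocalRing.exists_hasMultiplicationTable R.finrank_eq
  refine ⟨e ⟨T, R, hT⟩, ?_⟩
  rw [Function.comp_apply, e.symm_apply_apply]
  exact hT.nonempty_algEquiv (hA ⟨T, R, hT⟩)
end

section
/- Let F be a field of characteristic zero and n ≥ 0. Let P_i denote the space of polynomials in F[x] of degree at most i. An F-subspace W ⊆ P_n is invariant under all translations (i.e., for every a ∈ F, f(x) ∈ W implies f(x + a) ∈ W) if and only if W = 0 or W = P_i for some 0 ≤ i ≤ n. In particular, the translation-invariant subspaces of P_n form a full flag 0 ⊂ P_0 ⊂ P_1 ⊂ … ⊂ P_n, and each successive quotient P_{i+1}/P_i is one-dimensional with trivial induced translation action. -/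
open Polynomial

namespace Polynomial

/-- The coefficient of index `m` of a translate of a polynomial of degree at most `m + 1`. -/
theorem coeff_taylor_of_natDegree_le_succ {R : Type*} [CommSemiring R] {f : R[X]} {m : ℕ}
    (hf : f.natDegree ≤ m + 1) (a : R) :
    (taylor a f).coeff m = f.coeff m + (m + 1) * f.coeff (m + 1) * a := by
  have h : (hasseDeriv m f).natDegree < 2 := by
    have := natDegree_hasseDeriv_le f m
    omega
  rw [taylor_coeff, eval_eq_sum_range' h]
  simp [Finset.sum_range_succ, hasseDeriv_coeff, add_comm 1 m]

/-- The coefficient of index `m` of a translate of a polynomial of degree at most `m`. -/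
theorem coeff_taylor_of_natDegree_le {R : Type*} [CommSemiring R] {f : R[X]} {m : ℕ}
    (hf : f.natDegree ≤ m) (a : R) : (taylor a f).coeff m = f.coeff m := by
  simpa [coeff_eq_zero_of_natDegree_lt (Nat.lt_succ_of_le hf)] using
    coeff_taylor_of_natDegree_le_succ (hf.trans m.le_succ) a

theorem mem_degreeLE_natCast {R : Type*} [Semiring R] {m : ℕ} {f : R[X]} :
    f ∈ degreeLE R (m : ℕ) ↔ f.natDegree ≤ m := by
  rw [mem_degreeLE, natDegree_le_iff_degree_le]

theorem natDegree_le_of_le_succ_of_coeff_eq_zero {R : Type*} [Semiring R] {m : ℕ} {f : R[X]}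
    (hf : f.natDegree ≤ m + 1) (h : f.coeff (m + 1) = 0) : f.natDegree ≤ m := by
  rw [natDegree_le_iff_coeff_eq_zero] at hf ⊢
  intro k hk
  rcases Nat.eq_or_lt_of_le (Nat.succ_le_of_lt hk) with rfl | hk'
  · exact h
  · exact hf k hk'

theorem natDegree_taylor_sub_le {R : Type*} [CommRing R] {f : R[X]} {m : ℕ}
    (hf : f.natDegree ≤ m + 1) (a : R) : (taylor a f - f).natDegree ≤ m := by
  apply natDegree_le_of_le_succ_of_coeff_eq_zero
  · exact (natDegree_sub_le _ _).trans (by simp [hf])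
  · rw [coeff_sub, coeff_taylor_of_natDegree_le hf, sub_self]

/-- In characteristic zero, a translation-invariant subspace containing a polynomial of degree `m`
contains all polynomials of degree at most `m`. -/
theorem degreeLE_le_of_taylor_mem {F : Type*} [Field F] [CharZero F] {W : Submodule F F[X]}
    (hW : ∀ a : F, ∀ f ∈ W, taylor a f ∈ W) {m : ℕ} {f : F[X]} (hfW : f ∈ W)
    (hf : f.natDegree ≤ m) (hf0 : f.coeff m ≠ 0) : degreeLE F (m : ℕ) ≤ W := by
  induction m generalizing f with
  | zero =>
    intro g hg
    rw [mem_degreeLE_natCast] at hg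
    have : g = (g.coeff 0 / f.coeff 0) • f := by
      rw [eq_C_of_natDegree_le_zero hf, eq_C_of_natDegree_le_zero hg, smul_C]
      simp [hf0]
    rw [this]
    exact W.smul_mem _ hfW
  | succ m ih =>
    intro g hg
    rw [mem_degreeLE_natCast] at hg
    have hle : degreeLE F (m : ℕ) ≤ W := by
      refine ih (W.sub_mem (hW 1 f hfW) hfW) (natDegree_taylor_sub_le hf 1) ?_
      rw [coeff_sub, coeff_taylor_of_natDegree_le_succ hf]
      simpa [hf0] using Nat.cast_add_one_ne_zero m
    have hsub : g - (g.coeff (m + 1) / f.coeff (m + 1)) • f ∈ W := by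
      refine hle (mem_degreeLE_natCast.2 (natDegree_le_of_le_succ_of_coeff_eq_zero ?_ ?_))
      · exact natDegree_sub_le_of_le hg ((natDegree_smul_le _ _).trans hf) |>.trans (by simp)
      · simp [hf0]
    simpa using W.add_mem hsub (W.smul_mem (g.coeff (m + 1) / f.coeff (m + 1)) hfW)

theorem eq_bot_or_eq_degreeLE_of_taylor_mem {F : Type*} [Field F] [CharZero F]
    {W : Submodule F F[X]} (hW : ∀ a : F, ∀ f ∈ W, taylor a f ∈ W) {n : ℕ}
    (hn : W ≤ degreeLE F (n : ℕ)) : W = ⊥ ∨ ∃ i : ℕ, i ≤ n ∧ W = degreeLE F (i : ℕ) := by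
  induction n with
  | zero =>
    refine or_iff_not_imp_left.2 fun h => ⟨0, le_rfl, hn.antisymm ?_⟩
    obtain ⟨f, hfW, hf⟩ := W.exists_mem_ne_zero_of_ne_bot h
    have hd := mem_degreeLE_natCast.1 (hn hfW)
    refine degreeLE_le_of_taylor_mem hW hfW hd fun h0 => hf ?_
    rw [eq_C_of_natDegree_le_zero hd, h0, C_0]
  | succ n ih =>
    by_cases h : ∃ f ∈ W, f.coeff (n + 1) ≠ 0
    · obtain ⟨f, hfW, hf⟩ := h
      exact Or.inr ⟨n + 1, le_rfl, hn.antisymm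
        (degreeLE_le_of_taylor_mem hW hfW (mem_degreeLE_natCast.1 (hn hfW)) hf)⟩
    · push Not at h
      refine (ih fun f hf => mem_degreeLE_natCast.2 (natDegree_le_of_le_succ_of_coeff_eq_zero
        (mem_degreeLE_natCast.1 (hn hf)) (h f hf))).imp_right ?_
      rintro ⟨i, hi, rfl⟩
      exact ⟨i, hi.trans n.le_succ, rfl⟩

theorem finrank_degreeLE {F : Type*} [Field F] (m : ℕ) :
    Module.finrank F (degreeLE F (m : ℕ)) = m + 1 := by
  rw [← degreeLT_succ_eq_degreeLE, (degreeLTEquiv F (m + 1)).finrank_eq, Module.finrank_fin_fun]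

end Polynomial

/-- over a field F of characteristic zero, a subspace W of the space P_n of
polynomials of degree ≤ n is translation-invariant iff W = 0 or W = P_i for some 0 ≤ i ≤ n.
In particular the translation-invariant subspaces form a full flag
0 ⊂ P_0 ⊂ P_1 ⊂ … ⊂ P_n, and each successive quotient P_{i+1}/P_i is one-dimensional
with trivial induced translation action. -/
theorem stmt_14 (F : Type*) [Field F] [CharZero F] (n : ℕ) :
    (∀ W : Submodule F (Polynomial F), W ≤ Polynomial.degreeLE F (n : ℕ) →
      ((∀ a : F, ∀ f ∈ W, f.comp (Polynomial.X + Polynomial.C a) ∈ W) ↔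
        (W = ⊥ ∨ ∃ i : ℕ, i ≤ n ∧ W = Polynomial.degreeLE F (i : ℕ)))) ∧
    ((⊥ : Submodule F (Polynomial F)) < Polynomial.degreeLE F ((0 : ℕ) : WithBot ℕ)) ∧
    (∀ i : ℕ, i < n →
      Polynomial.degreeLE F (i : ℕ) < Polynomial.degreeLE F ((i + 1 : ℕ) : WithBot ℕ)) ∧
    (∀ i : ℕ, i < n →
      Module.finrank F (Polynomial.degreeLE F ((i + 1 : ℕ) : WithBot ℕ)) =
        Module.finrank F (Polynomial.degreeLE F (i : ℕ)) + 1) ∧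
    (∀ i : ℕ, i < n → ∀ a : F, ∀ f ∈ Polynomial.degreeLE F ((i + 1 : ℕ) : WithBot ℕ),
      f.comp (Polynomial.X + Polynomial.C a) - f ∈ Polynomial.degreeLE F (i : ℕ)) := by
  refine ⟨fun W hWn => ⟨fun hW => eq_bot_or_eq_degreeLE_of_taylor_mem hW hWn, ?_⟩,
    ?_, ?_, ?_, ?_⟩
  · rintro (rfl | ⟨i, -, rfl⟩) a f hf
    · simp_all
    · rw [← taylor_apply]
      simpa only [mem_degreeLE_natCast, natDegree_taylor] using hf
  · refine bot_lt_iff_ne_bot.2 ((Submodule.ne_bot_iff _).2 ⟨1, ?_, one_ne_zero⟩)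
    exact mem_degreeLE_natCast.2 natDegree_one.le
  · refine fun i _ => lt_of_le_of_ne (degreeLE_mono (by exact_mod_cast i.le_succ)) fun h => ?_
    have := congrArg (fun V : Submodule F F[X] => Module.finrank F V) h
    simp [-Nat.cast_add, finrank_degreeLE] at this
  · intro i _
    rw [finrank_degreeLE, finrank_degreeLE]
  · intro i _ a f hf
    exact mem_degreeLE_natCast.2 (natDegree_taylor_sub_le (mem_degreeLE_natCast.1 hf) a)
end
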